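/- There is an absolute constant C with the following property. Let k ∈ ℂ⁺ and let f ∈ C_c^∞(ℝ³; ℂ). For r > 0 and σ ∈ S² define μ₂(r,σ) := r ∫_{ℝ³} [e^{ik(−r+|rσ−y|+|y|)} / (4π |rσ−y| |y|)] f(y) dy. Then sup_{r>0} ‖μ₂(r,·)‖_{L²(S²)} ≤ C ( 1/|k|² + 1/(|k|² (Im k)²) + 1/(|k| (Im k)^{1/2}) + 1/(|k| (Im k)²) )^{1/2} ‖f‖_{2,w}. -/

import Mathlib

open MeasureTheory Metric

noncomputable section

/-- The kernel `e^{ik(−r+|rσ−y|+|y|)} / (4π |rσ−y| |y|)`. -/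
def ker (k : ℂ) (r : ℝ) (σ y : EuclideanSpace ℝ (Fin 3)) : ℂ :=
  Complex.exp (Complex.I * k * ((-r + ‖r • σ - y‖ + ‖y‖ : ℝ) : ℂ)) /
    ((4 * Real.pi * ‖r • σ - y‖ * ‖y‖ : ℝ) : ℂ)

/-- The weight `w(x) = 1` for `|x| > 1` and `w(x) = |x|⁻²` for `|x| ≤ 1`. -/
def wt (x : EuclideanSpace ℝ (Fin 3)) : ℝ := if 1 < ‖x‖ then 1 else (‖x‖ ^ 2)⁻¹

/-- `μ₂(r,σ) = r ∫ ker(k,r,σ,y) f(y) dy`. -/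
def mu2 (k : ℂ) (f : EuclideanSpace ℝ (Fin 3) → ℂ)
    (r : ℝ) (σ : EuclideanSpace ℝ (Fin 3)) : ℂ :=
  (r : ℂ) * ∫ y : EuclideanSpace ℝ (Fin 3), ker k r σ y * f y

end


open MeasureTheory Metric

namespace Mu2
open Set Filter Topology
open scoped Pointwise ENNReal NNReal

abbrev E3 := EuclideanSpace ℝ (Fin 3)
abbrev Sph := sphere (0 : E3) 1

noncomputable def nu : Measure Sph := (volume : Measure E3).toSphere

instance : IsFiniteMeasure nu := by unfold nu; infer_instance

lemma nu_univ : nu.real univ = 4 * Real.pi := by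
  unfold nu
  rw [Measure.toSphere_real_apply_univ, measureReal_def, EuclideanSpace.volume_ball_fin_three]
  rw [ENNReal.toReal_mul, ENNReal.toReal_ofReal (by positivity)]
  simp
  ring

lemma norm_sph (σ : Sph) : ‖(σ : E3)‖ = 1 := by simp

lemma integrable_sph {F : Type*} [NormedAddCommGroup F] {f : Sph → F} (hf : Continuous f) :
    Integrable f nu := by
  rw [← integrableOn_univ]
  exact hf.continuousOn.integrableOn_compact isCompact_univ

/-- Polar coordinates. -/
lemma polar_integral {F : Type*} [NormedAddCommGroup F] [NormedSpace ℝ F]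
    {f : E3 → F} (hf : Integrable f) :
    IntegrableOn (fun r : ℝ => r ^ 2 • ∫ σ : Sph, f (r • (σ : E3)) ∂nu) (Ioi 0) ∧
    ∫ x, f x = ∫ r in Ioi (0 : ℝ), r ^ 2 • ∫ σ : Sph, f (r • (σ : E3)) ∂nu := by
  have mp := (volume : Measure E3).measurePreserving_homeomorphUnitSphereProd
  have hdim : Module.finrank ℝ E3 - 1 = 2 := by simp
  rw [hdim] at mp
  have key : ∀ x : ({(0 : E3)}ᶜ : Set E3),
      f x = (fun p : Sph × Ioi (0:ℝ) => f ((p.2 : ℝ) • (p.1 : E3))) (homeomorphUnitSphereProd E3 x) := by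
    intro x
    have : (x : E3) = ((homeomorphUnitSphereProd E3).symm (homeomorphUnitSphereProd E3 x) : E3) := by
      simp
    conv_lhs => rw [this]
    rfl
  have hI : Integrable (fun p : Sph × Ioi (0:ℝ) => f ((p.2 : ℝ) • (p.1 : E3)))
      (nu.prod (Measure.volumeIoiPow 2)) := by
    have h1 : Integrable (fun x : ({(0 : E3)}ᶜ : Set E3) => f x) ((volume : Measure E3).comap Subtype.val) := by
      have := hf.integrableOn (s := ({(0 : E3)}ᶜ : Set E3))
      rwa [integrableOn_iff_comap_subtypeVal (by measurability)] at this
    have h2 := mp.integrable_comp_emb (Homeomorph.measurableEmbedding _)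
      (g := (fun p : Sph × Ioi (0:ℝ) => f ((p.2 : ℝ) • (p.1 : E3))))
    refine h2.1 ?_
    refine h1.congr (.of_forall fun x => key x)
  have hI2 := hI.integral_prod_right
  constructor
  · rw [integrableOn_iff_comap_subtypeVal (by measurability)]
    rw [Measure.volumeIoiPow, integrable_withDensity_iff_integrable_smul'] at hI2
    · refine hI2.congr (.of_forall ?_)
      rintro ⟨x, hx : 0 < x⟩
      simp (disch := positivity) [ENNReal.toReal_ofReal]
    · fun_prop
    · simp
  · calc
    ∫ x, f x = ∫ x : ({(0)}ᶜ : Set E3), f x ∂((volume : Measure E3).comap Subtype.val) := by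
      rw [integral_subtype_comap (measurableSet_singleton _).compl fun x ↦ f x,
        restrict_compl_singleton]
    _ = ∫ p : Sph × Ioi (0:ℝ), f ((p.2 : ℝ) • (p.1 : E3)) ∂(nu.prod (Measure.volumeIoiPow 2)) := by
      rw [show nu = (volume : Measure E3).toSphere from rfl, ← mp.integral_comp
        (Homeomorph.measurableEmbedding _)]
      exact integral_congr_ae (.of_forall fun x => key x)
    _ = ∫ r : Ioi (0:ℝ), ∫ σ : Sph, f ((r : ℝ) • (σ : E3)) ∂nu ∂(Measure.volumeIoiPow 2) :=
      integral_prod_symm _ hI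
    _ = _ := by
      simp only [Measure.volumeIoiPow]
      rw [integral_withDensity_eq_integral_toReal_smul, ← integral_subtype_comap measurableSet_Ioi
        (fun r : ℝ => r ^ 2 • ∫ σ : Sph, f (r • (σ : E3)) ∂nu)]
      · refine integral_congr_ae (.of_forall ?_)
        rintro ⟨x, hx : 0 < x⟩
        simp (disch := positivity) [ENNReal.toReal_ofReal]
      · fun_prop
      · simp

/-- Differentiation under the sphere integral. -/
lemma hasDerivAt_sph {F : Type*} [NormedAddCommGroup F] [NormedSpace ℝ F]
    {f f' : ℝ → Sph → F} (hf : ∀ r, Continuous (f r)) (hf' : Continuous (Function.uncurry f'))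
    (h : ∀ σ r, HasDerivAt (fun s => f s σ) (f' r σ) r) (r : ℝ) :
    HasDerivAt (fun s => ∫ σ, f s σ ∂nu) (∫ σ, f' r σ ∂nu) r := by
  obtain ⟨C, hC⟩ := ((isCompact_Icc (a := r - 1) (b := r + 1)).prod (isCompact_univ (X := Sph))).exists_bound_of_continuousOn
    hf'.continuousOn
  refine (hasDerivAt_integral_of_dominated_loc_of_deriv_le (bound := fun _ => C)
    (Icc_mem_nhds (by linarith : r - 1 < r) (by linarith : r < r + 1))
    (.of_forall fun x => (hf x).aestronglyMeasurable) (integrable_sph (hf r))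
    (hf'.uncurry_left r).aestronglyMeasurable
    (.of_forall fun σ x hx => hC (x, σ) ⟨hx, mem_univ _⟩) (integrable_const _)
    (.of_forall fun σ x hx => h σ x)).2

lemma continuous_sph_integral {F : Type*} [NormedAddCommGroup F] [NormedSpace ℝ F]
    {f : ℝ → Sph → F} (hf : Continuous (Function.uncurry f)) :
    Continuous (fun s => ∫ σ, f s σ ∂nu) := by
  have := continuous_parametric_integral_of_continuous (μ := nu) (f := f) hf isCompact_univ
  simpa using this

/-- Rotation invariance of the sphere measure. -/
lemma nu_rot (T : E3 ≃ₗᵢ[ℝ] E3) {F : Type*} [NormedAddCommGroup F] [NormedSpace ℝ F]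
    (f : E3 → F) : ∫ σ : Sph, f (T σ) ∂nu = ∫ σ : Sph, f σ ∂nu := by
  let e : Sph ≃ₜ Sph :=
    { toFun := fun σ => ⟨T σ, by simp⟩
      invFun := fun σ => ⟨T.symm σ, by simp⟩
      left_inv := fun σ => by simp
      right_inv := fun σ => by simp
      continuous_toFun := by fun_prop
      continuous_invFun := by fun_prop }
  have mp : MeasurePreserving e nu nu := by
    refine ⟨e.measurable, ?_⟩
    ext s hs
    rw [Measure.map_apply e.measurable hs]
    unfold nu
    rw [Measure.toSphere_apply' _ hs, Measure.toSphere_apply' _ (e.measurable hs)]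
    congr 1
    have hT : T ⁻¹' (Ioo (0 : ℝ) 1 • ((↑) '' s : Set E3)) = Ioo (0 : ℝ) 1 • ((↑) '' (e ⁻¹' s) : Set E3) := by
      ext x
      simp only [mem_preimage, Set.mem_smul, Set.mem_image]
      constructor
      · rintro ⟨a, ha, _, ⟨y, hy, rfl⟩, hxy⟩
        refine ⟨a, ha, _, ⟨e.symm y, by simpa using hy, rfl⟩, ?_⟩
        apply T.injective
        rw [← hxy]
        simp [e]
      · rintro ⟨a, ha, _, ⟨y, hy, rfl⟩, rfl⟩
        exact ⟨a, ha, _, ⟨e y, hy, rfl⟩, by simp [e]⟩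
    rw [← hT]
    exact (T.measurePreserving.measure_preimage_equiv (f := T.toHomeomorph.toMeasurableEquiv) _)
  exact mp.integral_comp e.measurableEmbedding (fun σ : Sph => f σ)
end Mu2

open MeasureTheory Metric
namespace Mu2
open Set Filter Topology
open scoped Pointwise ENNReal NNReal

noncomputable def e3 (i : Fin 3) : E3 := EuclideanSpace.single i 1

/-- The skew-symmetric generator of rotations in the coordinate plane `(j+1, j+2)`. -/
noncomputable def skA (j : Fin 3) : E3 →L[ℝ] E3 :=
  (EuclideanSpace.proj (𝕜 := ℝ) (j + 1) : E3 →L[ℝ] ℝ).smulRight (e3 (j + 2)) -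
    (EuclideanSpace.proj (𝕜 := ℝ) (j + 2) : E3 →L[ℝ] ℝ).smulRight (e3 (j + 1))

noncomputable def skP (j : Fin 3) : E3 →L[ℝ] E3 :=
  (EuclideanSpace.proj (𝕜 := ℝ) (j + 1) : E3 →L[ℝ] ℝ).smulRight (e3 (j + 1)) +
    (EuclideanSpace.proj (𝕜 := ℝ) (j + 2) : E3 →L[ℝ] ℝ).smulRight (e3 (j + 2))

noncomputable def rotL (j : Fin 3) (t : ℝ) : E3 →L[ℝ] E3 :=
  ContinuousLinearMap.id ℝ E3 + (Real.cos t - 1) • skP j + Real.sin t • skA j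

lemma rotL_norm (j : Fin 3) (t : ℝ) (x : E3) : ‖rotL j t x‖ = ‖x‖ := by
  rw [EuclideanSpace.norm_eq, EuclideanSpace.norm_eq]
  congr 1
  have h := Real.sin_sq_add_cos_sq t
  fin_cases j <;>
  simp [Fin.sum_univ_three, rotL, skA, skP, e3] <;>
  grind

noncomputable def rot (j : Fin 3) (t : ℝ) : E3 ≃ₗᵢ[ℝ] E3 :=
  LinearIsometry.toLinearIsometryEquiv ⟨(rotL j t).toLinearMap, rotL_norm j t⟩ rfl

lemma rot_apply (j : Fin 3) (t : ℝ) (x : E3) : rot j t x = rotL j t x := rfl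

lemma rotL_deriv (j : Fin 3) (x : E3) (t : ℝ) :
    HasDerivAt (fun s => rotL j s x) (skA j (rotL j t x)) t := by
  have h1 : HasDerivAt (fun s => rotL j s x)
      ((-Real.sin t) • skP j x + Real.cos t • skA j x) t := by
    have := ((((Real.hasDerivAt_cos t).sub_const 1).smul_const (skP j x)).const_add x).add
      ((Real.hasDerivAt_sin t).smul_const (skA j x))
    exact this
  convert h1 using 1
  ext i
  fin_cases j <;> fin_cases i <;>
  simp [rotL, skA, skP, e3] <;> ring

/-- The first-order operator `u ↦ du(Bx)`. -/
noncomputable def Lg (B : E3 →L[ℝ] E3) (u : E3 → ℂ) (x : E3) : ℂ := fderiv ℝ u x (B x)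

lemma contDiff_Lg (B : E3 →L[ℝ] E3) {u : E3 → ℂ} (hu : ContDiff ℝ (⊤ : ℕ∞) u) :
    ContDiff ℝ (⊤ : ℕ∞) (Lg B u) := by
  unfold Lg
  have := hu.fderiv_right (m := (⊤ : ℕ∞)) (by simp)
  fun_prop

lemma contDiff_dir (v : E3) {u : E3 → ℂ} (hu : ContDiff ℝ (⊤ : ℕ∞) u) :
    ContDiff ℝ (⊤ : ℕ∞) (fun x => fderiv ℝ u x v) := by
  have := hu.fderiv_right (m := (⊤ : ℕ∞)) (by simp)
  fun_prop

lemma fderiv_Lg (B : E3 →L[ℝ] E3) {u : E3 → ℂ} (hu : ContDiff ℝ (⊤ : ℕ∞) u) (x v : E3) :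
    fderiv ℝ (Lg B u) x v = fderiv ℝ (fderiv ℝ u) x v (B x) + fderiv ℝ u x (B v) := by
  have h := hu.fderiv_right (m := (⊤ : ℕ∞)) (by simp)
  have h1 : DifferentiableAt ℝ (fderiv ℝ u) x := (h.differentiable (by simp)) x
  unfold Lg
  rw [fderiv_clm_apply h1 (by fun_prop)]
  simp [add_comm]

lemma symm_snd {u : E3 → ℂ} (hu : ContDiff ℝ (⊤ : ℕ∞) u) (x v w : E3) :
    fderiv ℝ (fderiv ℝ u) x v w = fderiv ℝ (fderiv ℝ u) x w v := by
  have : ContDiffAt ℝ (⊤ : ℕ∞) u x := hu.contDiffAt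
  exact this.isSymmSndFDerivAt (by simp only [minSmoothness_of_isRCLikeNormedField]; exact WithTop.coe_le_coe.2 (le_top : (2 : ℕ∞) ≤ ⊤)) v w

/-- Rotation fields have mean zero over spheres. -/
lemma sph_Lg_zero (j : Fin 3) {u : E3 → ℂ} (hu : ContDiff ℝ (⊤ : ℕ∞) u) (r : ℝ) :
    ∫ σ : Sph, Lg (skA j) u (r • (σ : E3)) ∂nu = 0 := by
  have hc := contDiff_Lg (skA j) hu
  have hrc : Continuous (fun p : ℝ × E3 => rotL j p.1 p.2) := by
    simp only [rotL]
    have h1 : Continuous (fun p : ℝ × E3 => p.2 + (Real.cos p.1 - 1) • skP j p.2 + Real.sin p.1 • skA j p.2) := by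
      fun_prop
    exact h1
  have hd := hasDerivAt_sph (f := fun t σ => u (rotL j t (r • (σ : E3))))
    (f' := fun t σ => Lg (skA j) u (rotL j t (r • (σ : E3))))
    (fun t => by have := hu.continuous; fun_prop)
    (by
      have h2 := hc.continuous
      have h3 : Continuous (fun p : ℝ × Sph => rotL j p.1 (r • (p.2 : E3))) :=
        hrc.comp (f := fun p : ℝ × Sph => (p.1, r • (p.2 : E3))) (by fun_prop)
      exact h2.comp h3)
    (fun σ t => by
      have h4 : HasFDerivAt u (fderiv ℝ u (rotL j t (r • (σ : E3)))) (rotL j t (r • (σ : E3))) :=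
        ((hu.differentiable (by simp)) _).hasFDerivAt
      exact h4.comp_hasDerivAt t (rotL_deriv j (r • (σ : E3)) t)) 0
  have hconst : (fun t => ∫ σ : Sph, u (rotL j t (r • (σ : E3))) ∂nu) =
      fun _ => ∫ σ : Sph, u (r • (σ : E3)) ∂nu := by
    ext t
    have := nu_rot (rot j t) (fun x => u (r • x))
    simpa [rot_apply] using this
  rw [hconst] at hd
  have h5 := hd.unique (hasDerivAt_const _ _)
  have h6 : ∀ x : E3, rotL j 0 x = x := by intro x; simp [rotL]
  simpa [h6] using h5

/-- Integration by parts on spheres. -/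
lemma sph_parts (j : Fin 3) {u v : E3 → ℂ} (hu : ContDiff ℝ (⊤ : ℕ∞) u)
    (hv : ContDiff ℝ (⊤ : ℕ∞) v) (r : ℝ) :
    ∫ σ : Sph, Lg (skA j) u (r • (σ : E3)) * (starRingEnd ℂ) (v (r • (σ : E3))) ∂nu =
    - ∫ σ : Sph, u (r • (σ : E3)) * (starRingEnd ℂ) (Lg (skA j) v (r • (σ : E3))) ∂nu := by
  have hvc : ContDiff ℝ (⊤ : ℕ∞) (fun x => (starRingEnd ℂ) (v x)) :=
    Complex.conjCLE.contDiff.comp hv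
  have h := sph_Lg_zero j (hu.mul hvc) r
  have h1 : ∀ x, Lg (skA j) (fun x => u x * (starRingEnd ℂ) (v x)) x =
      Lg (skA j) u x * (starRingEnd ℂ) (v x) + u x * (starRingEnd ℂ) (Lg (skA j) v x) := by
    intro x
    have du := (hu.differentiable (by simp)) x
    have dv := (hv.differentiable (by simp)) x
    have h2 : HasFDerivAt (fun x => (starRingEnd ℂ) (v x))
        ((Complex.conjCLE : ℂ →L[ℝ] ℂ).comp (fderiv ℝ v x)) x :=
      (Complex.conjCLE : ℂ →L[ℝ] ℂ).hasFDerivAt.comp x dv.hasFDerivAt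
    unfold Lg
    have h3 : fderiv ℝ (fun x => u x * (starRingEnd ℂ) (v x)) x = _ := (du.hasFDerivAt.mul h2).fderiv
    rw [h3]
    simp
    ring
  have cu := (contDiff_Lg (skA j) hu).continuous
  have cv := (contDiff_Lg (skA j) hv).continuous
  have cu0 := hu.continuous
  have cv0 := hv.continuous
  simp only [h1] at h
  rw [integral_add (integrable_sph (by fun_prop)) (integrable_sph (by fun_prop))] at h
  exact eq_neg_of_add_eq_zero_left h

noncomputable def Lap (u : E3 → ℂ) (x : E3) : ℂ := ∑ i, fderiv ℝ (fderiv ℝ u) x (e3 i) (e3 i)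

lemma lap_polar {u : E3 → ℂ} (hu : ContDiff ℝ (⊤ : ℕ∞) u) (x : E3) :
    ∑ j, Lg (skA j) (Lg (skA j) u) x =
      ((‖x‖ ^ 2 : ℝ) : ℂ) * Lap u x - fderiv ℝ (fderiv ℝ u) x x x - 2 * fderiv ℝ u x x := by
  have h1 : ∀ j, Lg (skA j) (Lg (skA j) u) x =
      fderiv ℝ (fderiv ℝ u) x (skA j x) (skA j x) + fderiv ℝ u x (skA j (skA j x)) := by
    intro j
    exact fderiv_Lg _ hu x _
  simp only [h1]
  have hx : x = x 0 • e3 0 + x 1 • e3 1 + x 2 • e3 2 := by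
    ext i; fin_cases i <;> simp [e3]
  have hn : ‖x‖ ^ 2 = x 0 ^ 2 + x 1 ^ 2 + x 2 ^ 2 := by
    rw [EuclideanSpace.norm_sq_eq]; simp [Fin.sum_univ_three]
  have s01 := symm_snd hu x (e3 0) (e3 1)
  have s02 := symm_snd hu x (e3 0) (e3 2)
  have s12 := symm_snd hu x (e3 1) (e3 2)
  rw [hn]
  unfold Lap
  generalize hH : fderiv ℝ (fderiv ℝ u) x = H at *
  generalize hd : fderiv ℝ u x = d at *
  have a0 : skA 0 x = x 1 • e3 2 - x 2 • e3 1 := by simp [skA]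
  have a1 : skA 1 x = x 2 • e3 0 - x 0 • e3 2 := by simp [skA]
  have a2 : skA 2 x = x 0 • e3 1 - x 1 • e3 0 := by simp [skA]
  have b0 : skA 0 (skA 0 x) = - (x 1 • e3 1) - x 2 • e3 2 := by
    ext i; fin_cases i <;> simp [skA, e3]
  have b1 : skA 1 (skA 1 x) = - (x 2 • e3 2) - x 0 • e3 0 := by
    ext i; fin_cases i <;> simp [skA, e3]
  have b2 : skA 2 (skA 2 x) = - (x 0 • e3 0) - x 1 • e3 1 := by
    ext i; fin_cases i <;> simp [skA, e3]
  have hxx : H x x = H (x 0 • e3 0 + x 1 • e3 1 + x 2 • e3 2) (x 0 • e3 0 + x 1 • e3 1 + x 2 • e3 2) := by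
    rw [← hx]
  have hdx : d x = d (x 0 • e3 0 + x 1 • e3 1 + x 2 • e3 2) := by rw [← hx]
  rw [hxx, hdx]
  simp only [Fin.sum_univ_three, b0, b1, b2]
  simp only [a0, a1, a2]
  simp only [map_add, map_sub, map_smul, map_neg, add_apply,
    sub_apply, smul_apply, Complex.real_smul, smul_add, smul_sub]
  push_cast
  rw [s01, s02, s12]
  ring
end Mu2

open MeasureTheory Metric
namespace Mu2
open Set Filter Topology
open scoped Pointwise ENNReal NNReal

lemma ray1 {v : E3 → ℂ} (hv : ContDiff ℝ (⊤ : ℕ∞) v) (σ : E3) (r : ℝ) :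
    HasDerivAt (fun s : ℝ => v (s • σ)) (fderiv ℝ v (r • σ) σ) r := by
  have h : HasFDerivAt v (fderiv ℝ v (r • σ)) (r • σ) :=
    ((hv.differentiable (by simp)) _).hasFDerivAt
  have h2 : HasDerivAt (fun s : ℝ => s • σ) σ r := by
    simpa using (hasDerivAt_id r).smul_const σ
  exact h.comp_hasDerivAt r h2

lemma dir2 {v : E3 → ℂ} (hv : ContDiff ℝ (⊤ : ℕ∞) v) (w x z : E3) :
    fderiv ℝ (fun y => fderiv ℝ v y w) x z = fderiv ℝ (fderiv ℝ v) x z w := by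
  have h := hv.fderiv_right (m := (⊤ : ℕ∞)) (by simp)
  have h1 : DifferentiableAt ℝ (fderiv ℝ v) x := (h.differentiable (by simp)) x
  rw [fderiv_clm_apply h1 (by fun_prop)]
  simp

lemma ray2 {v : E3 → ℂ} (hv : ContDiff ℝ (⊤ : ℕ∞) v) (σ : E3) (r : ℝ) :
    HasDerivAt (fun s : ℝ => fderiv ℝ v (s • σ) σ) (fderiv ℝ (fderiv ℝ v) (r • σ) σ σ) r := by
  have := ray1 (contDiff_dir σ hv) σ r
  rwa [dir2 hv] at this

lemma cont_d1 {v : E3 → ℂ} (hv : ContDiff ℝ (⊤ : ℕ∞) v) :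
    Continuous (fderiv ℝ v) := (hv.fderiv_right (m := (⊤ : ℕ∞)) (by simp)).continuous

lemma cont_d2 {v : E3 → ℂ} (hv : ContDiff ℝ (⊤ : ℕ∞) v) :
    Continuous (fderiv ℝ (fderiv ℝ v)) :=
  ((hv.fderiv_right (m := (⊤ : ℕ∞)) (by simp)).fderiv_right (m := (⊤ : ℕ∞)) (by simp)).continuous

lemma cont_Lap {v : E3 → ℂ} (hv : ContDiff ℝ (⊤ : ℕ∞) v) : Continuous (Lap v) := by
  have := cont_d2 hv
  unfold Lap; fun_prop

noncomputable def G (k : ℂ) (y : E3) : ℂ :=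
  Complex.exp (Complex.I * k * (‖y‖ : ℂ)) / ((4 * Real.pi * ‖y‖ : ℝ) : ℂ)

lemma norm_exp_ik (k : ℂ) (r : ℝ) : ‖Complex.exp (Complex.I * k * (r : ℂ))‖ = Real.exp (-k.im * r) := by
  rw [Complex.norm_exp]
  simp

lemma G_integrable {k : ℂ} (hk : 0 < k.im) : Integrable (G k) := by
  have : Integrable (fun y : E3 => (fun r : ℝ => Complex.exp (Complex.I * k * (r : ℂ)) / ((4 * Real.pi * r : ℝ) : ℂ)) ‖y‖) := by
    rw [integrable_fun_norm_addHaar (volume : Measure E3)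
      (f := fun r : ℝ => Complex.exp (Complex.I * k * (r : ℂ)) / ((4 * Real.pi * r : ℝ) : ℂ))]
    have h0 : IntegrableOn (fun r : ℝ => (4 * Real.pi)⁻¹ * (r * Real.exp (-k.im * r))) (Ioi 0) := by
      have h := integrableOn_rpow_mul_exp_neg_mul_rpow (s := 1) (p := 1) (by norm_num) (by norm_num) hk
      refine Integrable.const_mul ?_ _
      refine h.congr_fun (fun x hx => ?_) measurableSet_Ioi
      simp
    refine Integrable.mono' h0 ?_ ?_
    · apply Measurable.aestronglyMeasurable
      fun_prop
    · filter_upwards [ae_restrict_mem measurableSet_Ioi] with r hr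
      have hr : 0 < r := hr
      have hp := Real.pi_pos
      rw [norm_smul, norm_div, norm_exp_ik, Complex.norm_real]
      simp only [finrank_euclideanSpace, Fintype.card_fin, Real.norm_eq_abs, abs_pow, abs_mul, abs_of_pos hr, abs_of_pos hp]
      norm_num
      apply le_of_eq
      field_simp
  exact this

/-- The fundamental solution property of `G k`. -/
lemma fund {k : ℂ} (hk : 0 < k.im) {v : E3 → ℂ} (hv : ContDiff ℝ (⊤ : ℕ∞) v)
    (hc : HasCompactSupport v) : ∫ y, G k y * (Lap v y + k ^ 2 * v y) = - v 0 := by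
  have c0 := hv.continuous
  have c1 := cont_d1 hv
  have c2 := cont_d2 hv
  have cL := cont_Lap hv
  obtain ⟨R, hR0, hR⟩ : ∃ R : ℝ, 0 < R ∧ ∀ x : E3, R < ‖x‖ → x ∉ tsupport v := by
    obtain ⟨R, hR0, hR⟩ := hc.isBounded.subset_closedBall_lt 0 (0 : E3)
    refine ⟨R, hR0, fun x hx hxs => ?_⟩
    have := hR hxs
    simp at this
    linarith
  have hz : ∀ x : E3, R < ‖x‖ → v x = 0 ∧ fderiv ℝ v x = 0 ∧ fderiv ℝ (fderiv ℝ v) x = 0 := by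
    intro x hx
    refine ⟨image_eq_zero_of_notMem_tsupport (hR x hx), ?_, ?_⟩
    · exact image_eq_zero_of_notMem_tsupport (fun h => hR x hx (tsupport_fderiv_subset ℝ h))
    · exact image_eq_zero_of_notMem_tsupport
        (fun h => hR x hx (tsupport_fderiv_subset ℝ (tsupport_fderiv_subset ℝ h)))
  have hcs : HasCompactSupport (fun y => Lap v y + k ^ 2 * v y) := by
    apply HasCompactSupport.intro (isCompact_closedBall (0 : E3) R)
    intro x hx
    have := hz x (by simpa using hx)
    simp [Lap, this]
  have hIntg : Integrable (fun y => G k y * (Lap v y + k ^ 2 * v y)) := by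
    obtain ⟨C, hC⟩ := (show Continuous (fun y => Lap v y + k ^ 2 * v y) by fun_prop).bounded_above_of_compact_support hcs
    exact (G_integrable hk).mul_bdd (c := C) (Continuous.aestronglyMeasurable (by fun_prop)) (.of_forall hC)
  obtain ⟨hp1, hp2⟩ := polar_integral hIntg
  rw [hp2]
  set V : ℝ → ℂ := fun r => ∫ σ : Sph, v (r • (σ : E3)) ∂nu with hV
  set V1 : ℝ → ℂ := fun r => ∫ σ : Sph, fderiv ℝ v (r • (σ : E3)) σ ∂nu with hV1
  set V2 : ℝ → ℂ := fun r => ∫ σ : Sph, fderiv ℝ (fderiv ℝ v) (r • (σ : E3)) σ σ ∂nu with hV2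
  have dV : ∀ r, HasDerivAt V (V1 r) r := fun r =>
    hasDerivAt_sph (f := fun r σ => v (r • (σ : E3))) (f' := fun r σ => fderiv ℝ v (r • (σ : E3)) σ)
      (fun r => by fun_prop) (by unfold Function.uncurry; fun_prop) (fun σ r => ray1 hv σ r) r
  have dV1 : ∀ r, HasDerivAt V1 (V2 r) r := fun r =>
    hasDerivAt_sph (f := fun r σ => fderiv ℝ v (r • (σ : E3)) σ)
      (f' := fun r σ => fderiv ℝ (fderiv ℝ v) (r • (σ : E3)) σ σ)
      (fun r => by fun_prop) (by unfold Function.uncurry; fun_prop) (fun σ r => ray2 hv σ r) r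
  have hLap : ∀ r : ℝ, (r : ℂ) ^ 2 * ∫ σ : Sph, Lap v (r • (σ : E3)) ∂nu =
      (r : ℂ) ^ 2 * V2 r + 2 * r * V1 r := by
    intro r
    have h1 : ∫ σ : Sph, ∑ j, Lg (skA j) (Lg (skA j) v) (r • (σ : E3)) ∂nu = 0 := by
      rw [integral_finsetSum]
      · exact Finset.sum_eq_zero fun j _ => sph_Lg_zero j (contDiff_Lg _ hv) r
      · intro j _
        have := (contDiff_Lg (skA j) (contDiff_Lg (skA j) hv)).continuous
        exact integrable_sph (by fun_prop)
    have h2 : ∀ σ : Sph, ∑ j, Lg (skA j) (Lg (skA j) v) (r • (σ : E3)) =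
        (r : ℂ) ^ 2 * Lap v (r • (σ : E3)) -
          ((r : ℂ) ^ 2 * fderiv ℝ (fderiv ℝ v) (r • (σ : E3)) σ σ + 2 * r * fderiv ℝ v (r • (σ : E3)) σ) := by
      intro σ
      rw [lap_polar hv]
      have : ‖r • (σ : E3)‖ ^ 2 = r ^ 2 := by rw [norm_smul, norm_sph]; simp
      rw [this]
      simp only [map_smul, smul_apply, Complex.real_smul]
      push_cast
      ring
    simp only [h2] at h1
    rw [integral_sub (integrable_sph (by fun_prop)) (integrable_sph (by fun_prop)),
      integral_add (integrable_sph (by fun_prop)) (integrable_sph (by fun_prop)),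
      integral_const_mul, integral_const_mul, integral_const_mul] at h1
    exact sub_eq_zero.1 h1
  set Q : ℝ → ℂ := fun r => Complex.exp (Complex.I * k * (r : ℂ)) *
    ((r * V1 r + V r) - Complex.I * k * (r * V r)) with hQ
  set Q' : ℝ → ℂ := fun r => Complex.exp (Complex.I * k * (r : ℂ)) *
    (r * V2 r + 2 * V1 r + k ^ 2 * (r * V r)) with hQ'
  have dQ : ∀ r, HasDerivAt Q (Q' r) r := by
    intro r
    have he : HasDerivAt (fun r : ℝ => Complex.exp (Complex.I * k * (r : ℂ)))
        (Complex.exp (Complex.I * k * (r : ℂ)) * (Complex.I * k * 1)) r :=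
      (((hasDerivAt_id r).ofReal_comp).const_mul (Complex.I * k)).cexp
    have hid : HasDerivAt (fun r : ℝ => (r : ℂ)) 1 r := (hasDerivAt_id r).ofReal_comp
    have := he.mul (((hid.mul (dV1 r)).add (dV r)).sub (((hid.mul (dV r))).const_mul (Complex.I * k)))
    refine this.congr_deriv ?_
    simp only [hQ', Pi.mul_apply, Pi.add_apply, Pi.sub_apply]
    linear_combination (-Complex.exp (Complex.I * k * (r : ℂ)) * k ^ 2 * (r * V r)) * Complex.I_sq
  have hcongr : ∀ r ∈ Ioi (0 : ℝ), r ^ 2 • ∫ σ : Sph, G k (r • (σ : E3)) *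
      (Lap v (r • (σ : E3)) + k ^ 2 * v (r • (σ : E3))) ∂nu = ((4 * Real.pi : ℝ) : ℂ)⁻¹ * Q' r := by
    intro r hr
    have hr : 0 < r := hr
    have hG : ∀ σ : Sph, G k (r • (σ : E3)) =
        Complex.exp (Complex.I * k * (r : ℂ)) / ((4 * Real.pi * r : ℝ) : ℂ) := by
      intro σ
      unfold G
      rw [norm_smul, norm_sph, Real.norm_eq_abs, abs_of_pos hr, mul_one]
    simp only [hG]
    rw [integral_const_mul, integral_add (integrable_sph (by fun_prop)) (integrable_sph (by fun_prop)),
      integral_const_mul]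
    have h3 := hLap r
    have hrc : (r : ℂ) ≠ 0 := by exact_mod_cast hr.ne'
    have hpc : (Real.pi : ℂ) ≠ 0 := by exact_mod_cast Real.pi_pos.ne'
    have h4 : (r : ℂ) * ∫ σ : Sph, Lap v (r • (σ : E3)) ∂nu = r * V2 r + 2 * V1 r := by
      apply mul_left_cancel₀ hrc
      linear_combination h3
    simp only [hQ', ← h4, Complex.real_smul]
    change _ * (_ / _ * (_ + k ^ 2 * V r)) = _
    push_cast
    field_simp
  rw [setIntegral_congr_fun measurableSet_Ioi hcongr, integral_const_mul]
  have hp3 : IntegrableOn Q' (Ioi 0) := by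
    have h5 := (hp1.congr_fun hcongr measurableSet_Ioi).const_mul ((4 * Real.pi : ℝ) : ℂ)
    refine h5.congr (.of_forall fun r => ?_)
    have hpc : (Real.pi : ℂ) ≠ 0 := by exact_mod_cast Real.pi_pos.ne'
    push_cast
    field_simp
  have hlim : Tendsto Q atTop (𝓝 0) := by
    refine tendsto_const_nhds.congr' ?_
    filter_upwards [eventually_gt_atTop R] with r hr
    have hz' : ∀ σ : Sph, v (r • (σ : E3)) = 0 ∧ fderiv ℝ v (r • (σ : E3)) = 0 := by
      intro σ
      have := hz (r • (σ : E3)) (by rw [norm_smul, norm_sph, Real.norm_eq_abs, mul_one]; exact hr.trans_le (le_abs_self r))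
      exact ⟨this.1, this.2.1⟩
    simp [hQ, hV, hV1, hz']
  rw [integral_Ioi_of_hasDerivAt_of_tendsto (dQ 0).continuousAt.continuousWithinAt (fun r _ => dQ r) hp3 hlim]
  have hQ0 : Q 0 = (4 * Real.pi : ℝ) * v 0 := by
    simp only [hQ, hV]
    simp [integral_const, nu_univ]
  rw [hQ0]
  have hpc : (Real.pi : ℂ) ≠ 0 := by exact_mod_cast Real.pi_pos.ne'
  push_cast
  field_simp
  simp
end Mu2

open MeasureTheory Metric
namespace Mu2
open Set Filter Topology
open scoped Pointwise ENNReal NNReal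

noncomputable def U (k : ℂ) (g : E3 → ℂ) (x : E3) : ℂ := ∫ y, G k y * g (x - y)

lemma U_conv (k : ℂ) (g : E3 → ℂ) :
    U k g = convolution (G k) g (ContinuousLinearMap.mul ℝ ℂ) volume := by
  ext x
  simp [U, convolution]

lemma contDiff_U {k : ℂ} (hk : 0 < k.im) {g : E3 → ℂ} (hg : ContDiff ℝ (⊤ : ℕ∞) g)
    (hc : HasCompactSupport g) : ContDiff ℝ (⊤ : ℕ∞) (U k g) := by
  rw [U_conv]
  exact hc.contDiff_convolution_right _ (G_integrable hk).locallyIntegrable hg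

lemma fderiv_U {k : ℂ} (hk : 0 < k.im) {g : E3 → ℂ} (hg : ContDiff ℝ (⊤ : ℕ∞) g)
    (hc : HasCompactSupport g) (x v : E3) :
    fderiv ℝ (U k g) x v = U k (fun y => fderiv ℝ g y v) x := by
  rw [U_conv, (hc.hasFDerivAt_convolution_right _ (G_integrable hk).locallyIntegrable
    (hg.of_le (by exact WithTop.coe_le_coe.2 (le_top : (1 : ℕ∞) ≤ ⊤))) x).fderiv,
    convolution_precompR_apply _ (G_integrable hk).locallyIntegrable (hc.fderiv ℝ) (cont_d1 hg), U_conv]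

lemma U_bound (k : ℂ) {g : E3 → ℂ} {C : ℝ} (hC : ∀ x, ‖g x‖ ≤ C) (x : E3) (hk : 0 < k.im) :
    ‖U k g x‖ ≤ (∫ y, ‖G k y‖) * C := by
  unfold U
  rw [← integral_mul_const]
  refine norm_integral_le_of_norm_le ((G_integrable hk).norm.mul_const C) (.of_forall fun y => ?_)
  rw [norm_mul]
  gcongr
  exact hC _

lemma U_bounds {k : ℂ} (hk : 0 < k.im) {g : E3 → ℂ} (hg : ContDiff ℝ (⊤ : ℕ∞) g)
    (hc : HasCompactSupport g) :
    ∃ C : ℝ, 0 ≤ C ∧ (∀ x, ‖U k g x‖ ≤ C) ∧ ∀ x v, ‖fderiv ℝ (U k g) x v‖ ≤ C * ‖v‖ := by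
  obtain ⟨C0, h0⟩ := hg.continuous.bounded_above_of_compact_support hc
  obtain ⟨C1, h1⟩ := (cont_d1 hg).bounded_above_of_compact_support (hc.fderiv ℝ)
  have hC0 : 0 ≤ C0 := (norm_nonneg _).trans (h0 0)
  have hC1 : 0 ≤ C1 := (norm_nonneg _).trans (h1 0)
  have hI : 0 ≤ ∫ y, ‖G k y‖ := integral_nonneg fun _ => norm_nonneg _
  refine ⟨(∫ y, ‖G k y‖) * (C0 + C1), by positivity, fun x => ?_, fun x v => ?_⟩
  · exact U_bound k (fun x => (h0 x).trans (by linarith)) x hk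
  · rw [fderiv_U hk hg hc]
    refine (U_bound k (C := (C0 + C1) * ‖v‖) (fun y => ?_) x hk).trans (by rw [mul_assoc])
    refine ((fderiv ℝ g y).le_opNorm v).trans ?_
    gcongr
    exact (h1 y).trans (by linarith)

lemma U_eq {k : ℂ} (hk : 0 < k.im) {g : E3 → ℂ} (hg : ContDiff ℝ (⊤ : ℕ∞) g)
    (hc : HasCompactSupport g) (x : E3) : Lap (U k g) x + k ^ 2 * U k g x = - g x := by
  have hcd : ∀ v, HasCompactSupport (fun y => fderiv ℝ g y v) := fun v =>
    hc.fderiv_apply ℝ v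
  have h1 : ∀ i, fderiv ℝ (fderiv ℝ (U k g)) x (e3 i) (e3 i) =
      ∫ y, G k y * fderiv ℝ (fderiv ℝ g) (x - y) (e3 i) (e3 i) := by
    intro i
    rw [← dir2 (contDiff_U hk hg hc)]
    have : (fun y => fderiv ℝ (U k g) y (e3 i)) = U k (fun y => fderiv ℝ g y (e3 i)) := by
      ext y; exact fderiv_U hk hg hc y _
    rw [this, fderiv_U hk (contDiff_dir _ hg) (hcd _)]
    unfold U
    simp only [dir2 hg]
  have hv : ContDiff ℝ (⊤ : ℕ∞) (fun y => g (x - y)) := hg.comp (by fun_prop)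
  have hvc : HasCompactSupport (fun y => g (x - y)) :=
    hc.comp_homeomorph (Homeomorph.subLeft x)
  have hf := fund hk hv hvc
  have hgd : Differentiable ℝ g := hg.differentiable (by simp)
  have d1 : ∀ (h : E3 → ℂ), Differentiable ℝ h → ∀ y w, fderiv ℝ (fun y => h (x - y)) y w = - fderiv ℝ h (x - y) w := by
    intro h hh y w
    have := (hh (x - y)).hasFDerivAt.comp y ((hasFDerivAt_id y).const_sub x)
    have h3 : fderiv ℝ (fun y => h (x - y)) y = _ := this.fderiv
    rw [h3]; simp
  have hLap : ∀ y, Lap (fun y => g (x - y)) y = Lap g (x - y) := by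
    intro y
    unfold Lap
    refine Finset.sum_congr rfl fun i _ => ?_
    rw [← dir2 hv, ← dir2 hg]
    have : (fun y => fderiv ℝ (fun y => g (x - y)) y (e3 i)) = fun y => (fun z => - fderiv ℝ g z (e3 i)) (x - y) := by
      ext y; exact d1 g hgd y _
    rw [this, d1 (fun z => - fderiv ℝ g z (e3 i)) (by exact ((contDiff_dir _ hg).differentiable (by simp)).neg)]
    rw [fderiv_fun_neg]
    simp
  simp only [hLap] at hf
  rw [sub_zero] at hf
  rw [← hf]
  have cL := cont_Lap hg
  have c2 := cont_d2 hg
  have hGi := G_integrable hk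
  have int2 : ∀ i, Integrable (fun y => G k y * fderiv ℝ (fderiv ℝ g) (x - y) (e3 i) (e3 i)) := by
    intro i
    obtain ⟨C, hC⟩ := (show Continuous (fun y => fderiv ℝ (fderiv ℝ g) y (e3 i) (e3 i)) by fun_prop).bounded_above_of_compact_support
      (by
        have := (hcd (e3 i)).fderiv_apply ℝ (e3 i)
        simpa only [dir2 hg] using this)
    exact hGi.mul_bdd (c := C) (Continuous.aestronglyMeasurable (by fun_prop)) (.of_forall fun y => hC _)
  have int0 : Integrable (fun y => G k y * g (x - y)) := by
    obtain ⟨C, hC⟩ := hg.continuous.bounded_above_of_compact_support hc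
    have := hg.continuous
    exact hGi.mul_bdd (c := C) (Continuous.aestronglyMeasurable (by fun_prop)) (.of_forall fun y => hC _)
  have e : ∀ y, G k y * (Lap g (x - y) + k ^ 2 * g (x - y)) =
      (∑ i, G k y * fderiv ℝ (fderiv ℝ g) (x - y) (e3 i) (e3 i)) + k ^ 2 * (G k y * g (x - y)) := by
    intro y
    unfold Lap
    rw [mul_add, Finset.mul_sum]; ring
  simp only [e]
  rw [integral_add (integrable_finsetSum _ fun i _ => int2 i) (int0.const_mul _),
    integral_finsetSum _ fun i _ => int2 i, integral_const_mul]
  unfold Lap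
  simp only [h1]
  rfl
end Mu2

open MeasureTheory Metric
namespace Mu2
open Set Filter Topology
open scoped Pointwise ENNReal NNReal

/-- Cauchy-Schwarz for real integrals. -/
lemma cs_int {X : Type*} [MeasurableSpace X] (μ : Measure X) {f g : X → ℝ}
    (hf : Integrable (fun x => f x ^ 2) μ) (hg : Integrable (fun x => g x ^ 2) μ)
    (hfg : Integrable (fun x => f x * g x) μ) :
    (∫ x, f x * g x ∂μ) ^ 2 ≤ (∫ x, f x ^ 2 ∂μ) * ∫ x, g x ^ 2 ∂μ := by
  have h : ∀ t : ℝ, 0 ≤ (∫ x, f x ^ 2 ∂μ) * (t * t) + (2 * ∫ x, f x * g x ∂μ) * t + ∫ x, g x ^ 2 ∂μ := by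
    intro t
    have h1 : 0 ≤ ∫ x, (t * f x + g x) ^ 2 ∂μ := integral_nonneg fun x => sq_nonneg _
    have h2 : ∀ x, (t * f x + g x) ^ 2 = (t * t) * f x ^ 2 + (2 * t) * (f x * g x) + g x ^ 2 := by
      intro x; ring
    simp only [h2] at h1
    rw [integral_add (f := fun x => t * t * f x ^ 2 + 2 * t * (f x * g x)) ((hf.const_mul _).add (hfg.const_mul _)) hg,
      integral_add (hf.const_mul _) (hfg.const_mul _), integral_const_mul, integral_const_mul] at h1
    linarith
  have := discrim_le_zero h
  unfold discrim at this
  nlinarith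

lemma decay_aux {α : ℝ} (hα : 0 < α) (C : ℝ) :
    Tendsto (fun r : ℝ => Real.exp (-(4 * α) * r) * (C * (1 + r) ^ 2 * Real.exp (2 * α * r) / 2)) atTop (𝓝 0) := by
  have h := Real.tendsto_pow_mul_exp_neg_atTop_nhds_zero 2
  have h1 : Tendsto (fun r : ℝ => 2 * α * r + 2 * α) atTop atTop :=
    tendsto_atTop_add_const_right _ _ (tendsto_id.const_mul_atTop (by positivity))
  have h2 := ((h.comp h1).const_mul (C / 2 * (Real.exp (2 * α)) / (2 * α) ^ 2))
  rw [mul_zero] at h2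
  refine h2.congr fun r => ?_
  have e1 : Real.exp (-(4 * α) * r) = Real.exp (-(2 * α * r)) * Real.exp (-(2 * α * r)) := by
    rw [← Real.exp_add]; ring_nf
  have e2 : Real.exp (-(2 * α * r + 2 * α)) = Real.exp (-(2 * α * r)) * Real.exp (-(2 * α)) := by
    rw [← Real.exp_add]; ring_nf
  simp only [Function.comp]
  rw [e1, e2, Real.exp_neg, Real.exp_neg]
  field_simp
  ring

lemma ode_bound {α κ W T C R0 : ℝ} (hα : 0 < α) (hκ : 0 < κ) 
    {a n p Φ Φ' N' Ψ Ψ' : ℝ → ℝ}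
    (ca : Continuous a) (cn : Continuous n) (cp : Continuous p)
    (ha : ∀ r, 0 ≤ a r) (hn : ∀ r, 0 ≤ n r) (hp : ∀ r, 0 ≤ p r)
    (hΦ : ∀ r, HasDerivAt Φ (Φ' r) r) (hΦ' : ∀ r, 0 < r → 2 * α * a r ^ 2 - p r * a r ≤ Φ' r)
    (hΦ0 : 0 ≤ Φ 0) (hΦa : ∀ r, Φ r ≤ a r ^ 2 / 2) (hR0 : 0 < R0) (hpR : ∀ r, R0 ≤ r → p r = 0)
    (hC : ∀ r, 0 ≤ r → a r ^ 2 ≤ C * (1 + r) ^ 2 * Real.exp (2 * α * r))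
    (hN : ∀ r, HasDerivAt (fun s => n s ^ 2) (N' r) r) (hN' : ∀ r, N' r ≤ 2 * a r * n r)
    (hn0 : n 0 = 0)
    (hΨ : ∀ r, HasDerivAt Ψ (Ψ' r) r) (hΨ' : ∀ r, 0 < r → Ψ' r ≤ p r * n r / κ)
    (hΨ0 : Ψ 0 = 0) (hΨn : ∀ r, n r ^ 2 ≤ Ψ r + a r * n r / κ)
    (hW : ∀ R, 0 ≤ R → ∫ r in (0 : ℝ)..R, p r ^ 2 ≤ W)
    (hT : ∀ R, 0 ≤ R → ∫ r in (0 : ℝ)..R, p r ≤ T) (R : ℝ) (hR : 0 ≤ R) :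
    n R ≤ 3 * Real.sqrt (W / (4 * α ^ 2) / κ) + T / κ := by
  have cΦ : Continuous Φ := continuous_iff_continuousAt.2 fun r => (hΦ r).continuousAt
  have cΨ : Continuous Ψ := continuous_iff_continuousAt.2 fun r => (hΨ r).continuousAt
  -- step A
  have stepA : ∀ r, R0 ≤ r → Φ r ≤ 0 := by
    intro r hr
    set h : ℝ → ℝ := fun s => Real.exp (-(4 * α) * s) * Φ s with hh
    have hd : ∀ s, HasDerivAt h (Real.exp (-(4 * α) * s) * (-(4 * α)) * Φ s + Real.exp (-(4 * α) * s) * Φ' s) s := by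
      intro s
      have h1 : HasDerivAt (fun s : ℝ => -(4 * α) * s) (-(4 * α)) s := by
        simpa using (hasDerivAt_id s).const_mul (-(4 * α))
      exact h1.exp.mul (hΦ s)
    have hm : MonotoneOn h (Ici R0) := by
      refine monotoneOn_of_deriv_nonneg (convex_Ici _) (by
        exact (continuous_iff_continuousAt.2 fun r => (hd r).continuousAt).continuousOn)
        (fun s _ => (hd s).differentiableAt.differentiableWithinAt) fun s hs => ?_
      rw [interior_Ici] at hs
      rw [(hd s).deriv]
      have hs' : R0 < s := hs
      have q := hΦ' s (hR0.trans hs')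
      rw [hpR s hs'.le] at q
      have q2 := hΦa s
      have : 0 ≤ Φ' s - 4 * α * Φ s := by nlinarith
      have := mul_nonneg (Real.exp_pos (-(4 * α) * s)).le this
      linarith
    have hle : h r ≤ 0 := by
      refine ge_of_tendsto (decay_aux hα C) ?_
      filter_upwards [eventually_ge_atTop r] with s hs
      refine (hm hr (hr.trans hs) hs).trans ?_
      simp only [hh]
      gcongr
      refine (hΦa s).trans ?_
      have := hC s (by linarith)
      linarith
    by_contra hcon
    push Not at hcon
    have := mul_pos (Real.exp_pos (-(4 * α) * r)) hcon
    simp only [hh] at hle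
    linarith
  set D := W / (4 * α ^ 2) with hD
  have ii : ∀ {f : ℝ → ℝ}, Continuous f → ∀ x y, IntervalIntegrable f volume x y :=
    fun hf x y => hf.intervalIntegrable x y
  have stepB : ∀ x y, 0 ≤ x → x ≤ y → ∫ r in x..y, a r ^ 2 ≤ D := by
    intro x y hx hxy
    set Z := max y R0 with hZ
    have hZ0 : 0 ≤ Z := hR0.le.trans (le_max_right _ _)
    have h1 : ∫ r in (0 : ℝ)..Z, (2 * α * a r ^ 2 - p r * a r) ≤ Φ Z - Φ 0 :=
      intervalIntegral.integral_le_sub_of_hasDeriv_right_of_le hZ0 cΦ.continuousOn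
        (fun r _ => (hΦ r).hasDerivWithinAt)
        ((show Continuous fun r => 2 * α * a r ^ 2 - p r * a r by fun_prop).continuousOn.integrableOn_compact isCompact_Icc)
        (fun r hr => hΦ' r hr.1)
    have h2 : ∫ r in (0 : ℝ)..Z, (α * a r ^ 2 - 1 / (4 * α) * p r ^ 2) ≤ ∫ r in (0 : ℝ)..Z, (2 * α * a r ^ 2 - p r * a r) := by
      refine intervalIntegral.integral_mono hZ0 (ii (by fun_prop) _ _) (ii (by fun_prop) _ _) fun r => ?_
      have : 0 ≤ α * (a r - p r / (2 * α)) ^ 2 := by positivity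
      have e : α * (a r - p r / (2 * α)) ^ 2 = α * a r ^ 2 - p r * a r + 1 / (4 * α) * p r ^ 2 := by
        field_simp; ring
      simp only
      linarith
    rw [intervalIntegral.integral_sub (ii (by fun_prop) _ _) (ii (by fun_prop) _ _),
      intervalIntegral.integral_const_mul, intervalIntegral.integral_const_mul] at h2
    have h3 := hW Z hZ0
    have h4 := stepA Z (le_max_right _ _)
    have h5 : α * ∫ r in (0 : ℝ)..Z, a r ^ 2 ≤ 1 / (4 * α) * W := by
      have : 1 / (4 * α) * ∫ r in (0 : ℝ)..Z, p r ^ 2 ≤ 1 / (4 * α) * W := by gcongr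
      linarith
    have h6 : ∫ r in (0 : ℝ)..Z, a r ^ 2 ≤ D := by
      rw [hD, le_div_iff₀ (by positivity)]
      have := mul_le_mul_of_nonneg_left h5 (show 0 ≤ 4 * α by positivity)
      have e : 4 * α * (1 / (4 * α) * W) = W := by field_simp
      rw [e] at this
      linarith
    refine le_trans ?_ h6
    exact intervalIntegral.integral_mono_interval hx hxy (le_max_left _ _)
      (.of_forall fun r => sq_nonneg _) (ii (by fun_prop) _ _)
  obtain ⟨q, hq, hmax⟩ := (isCompact_Icc (a := (0 : ℝ)) (b := R)).exists_isMaxOn ⟨0, ⟨le_rfl, hR⟩⟩ cn.continuousOn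
  set M := n q with hM
  have hMR : n R ≤ M := hmax ⟨hR, le_rfl⟩
  refine hMR.trans ?_
  have hT0 : 0 ≤ T := by simpa using hT 0 le_rfl
  have hM0 : 0 ≤ M := hn q
  have hD0 : 0 ≤ D := by simpa using stepB 0 0 le_rfl le_rfl
  rcases hM0.eq_or_lt with hM0 | hM0
  · rw [← hM0]; positivity
  set sD := Real.sqrt (D / κ) with hsD
  have hsD0 : 0 ≤ sD := Real.sqrt_nonneg _
  have hsq : sD ^ 2 = D / κ := Real.sq_sqrt (by positivity)
  have inc : ∀ s, 0 ≤ s → s ≤ q → q - s ≤ 1 / κ → n q ^ 2 - n s ^ 2 ≤ 2 * M * sD := by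
    intro s hs hsq' hl
    have cn2 : Continuous fun s => n s ^ 2 := by fun_prop
    have h1 : n q ^ 2 - n s ^ 2 ≤ ∫ r in s..q, 2 * M * a r :=
      intervalIntegral.sub_le_integral_of_hasDeriv_right_of_le hsq' cn2.continuousOn
        (fun r _ => (hN r).hasDerivWithinAt)
        ((show Continuous fun r => 2 * M * a r by fun_prop).continuousOn.integrableOn_compact isCompact_Icc)
        (fun r hr => by
          have := hmax (show r ∈ Icc 0 R from ⟨hs.trans hr.1.le, hr.2.le.trans hq.2⟩)
          simp only [mem_ofPred_eq] at this
          refine (hN' r).trans ?_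
          have := mul_le_mul_of_nonneg_left this (ha r)
          linarith)
    rw [intervalIntegral.integral_const_mul] at h1
    refine h1.trans ?_
    gcongr
    have hcs := cs_int (volume.restrict (Ioc s q)) (f := fun _ => (1 : ℝ)) (g := a) (by
      simp) (((show Continuous fun r => a r ^ 2 by fun_prop).integrableOn_Ioc)) (by
        simp only [one_mul]; exact ca.integrableOn_Ioc)
    have hB := stepB s q hs hsq'
    rw [intervalIntegral.integral_of_le hsq'] at hB ⊢
    simp only [one_mul, one_pow] at hcs
    refine Real.le_sqrt_of_sq_le (hcs.trans ?_)
    have : ∫ x in Ioc s q, (1 : ℝ) = q - s := by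
      simp [hsq']
    rw [this, div_eq_mul_one_div D κ, mul_comm]
    have h0 : 0 ≤ ∫ x in Ioc s q, a x ^ 2 := integral_nonneg fun _ => sq_nonneg _
    gcongr
  suffices hfin : M ^ 2 ≤ M * (3 * sD + T / κ) by
    rw [sq] at hfin
    exact le_of_mul_le_mul_left hfin hM0
  have hTk : 0 ≤ T / κ := by positivity
  by_cases hcase : q < 1 / κ
  · have := inc 0 le_rfl hq.1 (by linarith)
    rw [hn0] at this
    have h5 : 0 ≤ M * (sD + T / κ) := by positivity
    nlinarith
  push Not at hcase
  have hκ1 : 0 < 1 / κ := by positivity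
  obtain ⟨s, hs, hmin⟩ := (isCompact_Icc (a := q - 1 / κ) (b := q)).exists_isMinOn ⟨q, ⟨by linarith, le_rfl⟩⟩ ca.continuousOn
  have hs0 : 0 ≤ s := by linarith [hs.1]
  have has : a s ≤ κ * sD := by
    have h1 : ∫ r in (q - 1 / κ)..q, a s ^ 2 ≤ ∫ r in (q - 1 / κ)..q, a r ^ 2 := by
      refine intervalIntegral.integral_mono_on (by linarith) (by simp) (ii (by fun_prop) _ _) fun r hr => ?_
      have := hmin hr
      simp only [mem_ofPred_eq] at this
      have := ha s
      gcongr
    have h2 := h1.trans (stepB _ _ (by linarith) (by linarith))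
    rw [intervalIntegral.integral_const, smul_eq_mul] at h2
    have h3 : a s ^ 2 ≤ (κ * sD) ^ 2 := by
      rw [mul_pow, hsq]
      have e : κ ^ 2 * (D / κ) = κ * D := by field_simp
      rw [e]
      have := mul_le_mul_of_nonneg_left h2 hκ.le
      have e2 : κ * ((q - (q - 1 / κ)) * a s ^ 2) = a s ^ 2 := by field_simp; ring
      linarith
    exact (sq_le_sq₀ (ha s) (by positivity)).1 h3
  have hi := inc s hs0 hs.2 (by linarith [hs.1])
  have hns : n s ≤ M := hmax (show s ∈ Icc 0 R from ⟨hs0, hs.2.trans hq.2⟩)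
  have hΨs : Ψ s - Ψ 0 ≤ ∫ r in (0 : ℝ)..s, M / κ * p r :=
    intervalIntegral.sub_le_integral_of_hasDeriv_right_of_le hs0 cΨ.continuousOn
      (fun r _ => (hΨ r).hasDerivWithinAt)
      ((show Continuous fun r => M / κ * p r by fun_prop).continuousOn.integrableOn_compact isCompact_Icc)
      (fun r hr => by
        have := hmax (show r ∈ Icc 0 R from ⟨hr.1.le, hr.2.le.trans (hs.2.trans hq.2)⟩)
        simp only [mem_ofPred_eq] at this
        refine (hΨ' r hr.1).trans ?_
        have := mul_le_mul_of_nonneg_left this (hp r)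
        rw [div_mul_eq_mul_div, mul_comm M]
        gcongr)
  rw [intervalIntegral.integral_const_mul, hΨ0, sub_zero] at hΨs
  have h7 : M / κ * ∫ r in (0 : ℝ)..s, p r ≤ M / κ * T := by
    have := hT s hs0
    gcongr
  have h8 : a s * n s / κ ≤ sD * M := by
    rw [div_le_iff₀ hκ]
    have := mul_le_mul has hns (hn s) (by positivity)
    linarith
  have h9 := hΨn s
  have h10 : M / κ * T = M * (T / κ) := by ring
  rw [← hM] at hi
  linarith
end Mu2

open MeasureTheory Metric
namespace Mu2
open Set Filter Topology
open scoped Pointwise ENNReal NNReal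

noncomputable def cE (k : ℂ) (r : ℝ) : ℂ := Complex.exp (-(Complex.I * k) * (r : ℂ))

lemma ofReal_deriv (r : ℝ) : HasDerivAt (fun s : ℝ => (s : ℂ)) 1 r :=
  (hasDerivAt_id r).ofReal_comp

lemma cE_deriv (k : ℂ) (r : ℝ) : HasDerivAt (cE k) (-(Complex.I * k) * cE k r) r := by
  have h : HasDerivAt (fun s : ℝ => -(Complex.I * k) * (s : ℂ)) (-(Complex.I * k)) r := by
    exact ((ofReal_deriv r).const_mul (-(Complex.I * k))).congr_deriv (mul_one _)
  exact h.cexp.congr_deriv (mul_comm _ _)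

@[fun_prop]
lemma cE_cont (k : ℂ) : Continuous (cE k) := by unfold cE; fun_prop

lemma cE_norm (k : ℂ) (r : ℝ) : ‖cE k r‖ = Real.exp (k.im * r) := by
  unfold cE
  rw [Complex.norm_exp]
  simp

noncomputable def mm (k : ℂ) (u : E3 → ℂ) (r : ℝ) (σ : Sph) : ℂ :=
  cE k r * ((r : ℂ) * u (r • (σ : E3)))

noncomputable def mm1 (k : ℂ) (u : E3 → ℂ) (r : ℝ) (σ : Sph) : ℂ :=
  cE k r * ((1 - Complex.I * k * r) * u (r • (σ : E3)) + r * fderiv ℝ u (r • (σ : E3)) σ)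

noncomputable def mm2 (k : ℂ) (u : E3 → ℂ) (r : ℝ) (σ : Sph) : ℂ :=
  cE k r * ((-2 * Complex.I * k - k ^ 2 * r) * u (r • (σ : E3)) +
    (2 - 2 * Complex.I * k * r) * fderiv ℝ u (r • (σ : E3)) σ +
    r * fderiv ℝ (fderiv ℝ u) (r • (σ : E3)) σ σ)

noncomputable def bb (k : ℂ) (v : E3 → ℂ) (r : ℝ) (σ : Sph) : ℂ :=
  cE k r * v (r • (σ : E3))

noncomputable def bb1 (k : ℂ) (v : E3 → ℂ) (r : ℝ) (σ : Sph) : ℂ :=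
  cE k r * (-(Complex.I * k) * v (r • (σ : E3)) + fderiv ℝ v (r • (σ : E3)) σ)

variable {k : ℂ} {u : E3 → ℂ}

lemma mm_deriv (hu : ContDiff ℝ (⊤ : ℕ∞) u) (σ : Sph) (r : ℝ) :
    HasDerivAt (fun s => mm k u s σ) (mm1 k u r σ) r := by
  have := (cE_deriv k r).mul ((ofReal_deriv r).mul (ray1 hu σ r))
  refine this.congr_deriv ?_
  simp only [Pi.mul_apply]
  unfold mm1; ring

lemma mm1_deriv (hu : ContDiff ℝ (⊤ : ℕ∞) u) (σ : Sph) (r : ℝ) :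
    HasDerivAt (fun s => mm1 k u s σ) (mm2 k u r σ) r := by
  have h1 : HasDerivAt (fun s : ℝ => 1 - Complex.I * k * (s : ℂ)) (-(Complex.I * k * 1)) r :=
    ((ofReal_deriv r).const_mul (Complex.I * k)).const_sub 1
  have := (cE_deriv k r).mul ((h1.mul (ray1 hu σ r)).add ((ofReal_deriv r).mul (ray2 hu σ r)))
  refine this.congr_deriv ?_
  simp only [Pi.mul_apply, Pi.add_apply]
  unfold mm2
  linear_combination (k ^ 2 * cE k r * r * u (r • (σ : E3))) * Complex.I_sq

lemma bb_deriv (hu : ContDiff ℝ (⊤ : ℕ∞) u) (σ : Sph) (r : ℝ) :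
    HasDerivAt (fun s => bb k u s σ) (bb1 k u r σ) r := by
  have := (cE_deriv k r).mul (ray1 hu σ r)
  refine this.congr_deriv ?_
  unfold bb1; ring

lemma mm_cont (hu : ContDiff ℝ (⊤ : ℕ∞) u) : Continuous (Function.uncurry (mm k u)) := by
  have := hu.continuous
  unfold mm Function.uncurry; fun_prop

lemma mm1_cont (hu : ContDiff ℝ (⊤ : ℕ∞) u) : Continuous (Function.uncurry (mm1 k u)) := by
  have := hu.continuous
  have := cont_d1 hu
  unfold mm1 Function.uncurry; fun_prop

lemma mm2_cont (hu : ContDiff ℝ (⊤ : ℕ∞) u) : Continuous (Function.uncurry (mm2 k u)) := by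
  have := hu.continuous
  have := cont_d1 hu
  have := cont_d2 hu
  unfold mm2 Function.uncurry; fun_prop

lemma bb_cont (hu : ContDiff ℝ (⊤ : ℕ∞) u) : Continuous (Function.uncurry (bb k u)) := by
  have := hu.continuous
  unfold bb Function.uncurry; fun_prop

lemma bb1_cont (hu : ContDiff ℝ (⊤ : ℕ∞) u) : Continuous (Function.uncurry (bb1 k u)) := by
  have := hu.continuous
  have := cont_d1 hu
  unfold bb1 Function.uncurry; fun_prop

/-- the sesquilinear pairing over the sphere -/
noncomputable def SP (a b : ℝ → Sph → ℂ) (r : ℝ) : ℂ :=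
  ∫ σ, a r σ * (starRingEnd ℂ) (b r σ) ∂nu

lemma SP_cont {a b : ℝ → Sph → ℂ} (ha : Continuous (Function.uncurry a))
    (hb : Continuous (Function.uncurry b)) : Continuous (SP a b) := by
  refine continuous_sph_integral (f := fun r σ => a r σ * (starRingEnd ℂ) (b r σ)) ?_
  have : Continuous fun p : ℝ × Sph => Function.uncurry a p * (starRingEnd ℂ) (Function.uncurry b p) := by
    fun_prop
  exact this

lemma SP_deriv {a b a' b' : ℝ → Sph → ℂ} (ha : Continuous (Function.uncurry a))
    (hb : Continuous (Function.uncurry b)) (ha' : Continuous (Function.uncurry a'))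
    (hb' : Continuous (Function.uncurry b')) (da : ∀ σ r, HasDerivAt (fun s => a s σ) (a' r σ) r)
    (db : ∀ σ r, HasDerivAt (fun s => b s σ) (b' r σ) r) (r : ℝ) :
    HasDerivAt (SP a b) (SP a' b r + SP a b' r) r := by
  have hI : ∀ {f g : ℝ → Sph → ℂ}, Continuous (Function.uncurry f) → Continuous (Function.uncurry g) →
      Continuous (fun σ => f r σ * (starRingEnd ℂ) (g r σ)) := by
    intro f g hf hg
    have h1 := hf.uncurry_left r
    have h2 := hg.uncurry_left r
    fun_prop
  unfold SP
  rw [← integral_add (integrable_sph (hI ha' hb)) (integrable_sph (hI ha hb'))]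
  refine hasDerivAt_sph (f := fun r σ => a r σ * (starRingEnd ℂ) (b r σ))
    (f' := fun r σ => a' r σ * (starRingEnd ℂ) (b r σ) + a r σ * (starRingEnd ℂ) (b' r σ)) ?_ ?_ ?_ r
  · intro s
    have h1 := ha.uncurry_left s
    have h2 := hb.uncurry_left s
    fun_prop
  · have : Continuous fun p : ℝ × Sph => Function.uncurry a' p * (starRingEnd ℂ) (Function.uncurry b p)
      + Function.uncurry a p * (starRingEnd ℂ) (Function.uncurry b' p) := by
      fun_prop
    exact this
  · intro σ s
    exact (da σ s).mul (db σ s).star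

lemma SP_conj (a b : ℝ → Sph → ℂ) (r : ℝ) : SP b a r = (starRingEnd ℂ) (SP a b r) := by
  unfold SP
  rw [← integral_conj]
  congr 1; ext σ
  simp [mul_comm]

noncomputable def SN (a : ℝ → Sph → ℂ) (r : ℝ) : ℝ := ∫ σ, ‖a r σ‖ ^ 2 ∂nu

lemma SN_nonneg (a : ℝ → Sph → ℂ) (r : ℝ) : 0 ≤ SN a r := integral_nonneg fun _ => by positivity

lemma SN_SP (a : ℝ → Sph → ℂ) (r : ℝ) : SP a a r = ((SN a r : ℝ) : ℂ) := by
  unfold SP SN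
  rw [show ((∫ σ, ‖a r σ‖ ^ 2 ∂nu : ℝ) : ℂ) = ∫ σ, ((‖a r σ‖ ^ 2 : ℝ) : ℂ) ∂nu from integral_ofReal.symm]
  congr 1; ext σ
  rw [Complex.mul_conj']; simp

lemma SN_cont {a : ℝ → Sph → ℂ} (ha : Continuous (Function.uncurry a)) : Continuous (SN a) := by
  refine continuous_sph_integral (f := fun r σ => ‖a r σ‖ ^ 2) ?_
  have : Continuous fun p : ℝ × Sph => ‖Function.uncurry a p‖ ^ 2 := by
    fun_prop
  exact this

lemma SN_deriv {a a' : ℝ → Sph → ℂ} (ha : Continuous (Function.uncurry a))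
    (ha' : Continuous (Function.uncurry a')) (da : ∀ σ r, HasDerivAt (fun s => a s σ) (a' r σ) r)
    (r : ℝ) : HasDerivAt (SN a) (2 * (SP a' a r).re) r := by
  have h := SP_deriv ha ha ha' ha' da da r
  have h2 := Complex.reCLM.hasFDerivAt.comp_hasDerivAt r h
  have e : SN a = Complex.reCLM ∘ SP a a := by
    ext s; simp [SN_SP]
  rw [e]
  refine h2.congr_deriv ?_
  rw [SP_conj a' a]
  simp; ring

lemma SP_le {a b : ℝ → Sph → ℂ} (ha : Continuous (Function.uncurry a))
    (hb : Continuous (Function.uncurry b)) (r : ℝ) :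
    ‖SP a b r‖ ≤ Real.sqrt (SN a r) * Real.sqrt (SN b r) := by
  have h1 := ha.uncurry_left r
  have h2 := hb.uncurry_left r
  rw [← Real.sqrt_mul (SN_nonneg a r)]
  have h3 : ‖SP a b r‖ ≤ ∫ σ, ‖a r σ‖ * ‖b r σ‖ ∂nu := by
    refine (norm_integral_le_integral_norm _).trans (le_of_eq ?_)
    simp
  refine h3.trans (Real.le_sqrt_of_sq_le ?_)
  exact cs_int nu (integrable_sph (by fun_prop)) (integrable_sph (by fun_prop)) (integrable_sph (by fun_prop))

/-- The equation along rays. -/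
lemma ray_pde (hu : ContDiff ℝ (⊤ : ℕ∞) u) {g : E3 → ℂ}
    (hg : ∀ x, Lap u x + k ^ 2 * u x = - g x) (r : ℝ) (σ : Sph) :
    r * mm2 k u r σ + 2 * Complex.I * k * (r * mm1 k u r σ)
      + ∑ j, cE k r * Lg (skA j) (Lg (skA j) u) (r • (σ : E3)) = - (r * mm k g r σ) := by
  rw [← Finset.mul_sum, lap_polar hu]
  have h := hg (r • (σ : E3))
  have hn : ‖r • (σ : E3)‖ ^ 2 = r ^ 2 := by
    rw [norm_smul, norm_sph]; simp
  rw [hn]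
  simp only [map_smul, _root_.smul_apply, Complex.real_smul]
  unfold mm2 mm1 mm
  push_cast
  linear_combination (cE k r * r ^ 2) * h - (2 * k ^ 2 * r ^ 2 * cE k r * u (r • (σ : E3))) * Complex.I_sq

lemma Lg_comm (B : E3 →L[ℝ] E3) (hu : ContDiff ℝ (⊤ : ℕ∞) u) (x : E3) :
    Lg B (Lg (ContinuousLinearMap.id ℝ E3) u) x = Lg (ContinuousLinearMap.id ℝ E3) (Lg B u) x := by
  show fderiv ℝ (Lg (ContinuousLinearMap.id ℝ E3) u) x (B x) = fderiv ℝ (Lg B u) x x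
  rw [fderiv_Lg _ hu, fderiv_Lg _ hu]
  simp [symm_snd hu x (B x) x]

lemma pair1 (j : Fin 3) (hu : ContDiff ℝ (⊤ : ℕ∞) u) (r : ℝ) :
    ∫ σ, (cE k r * Lg (skA j) (Lg (skA j) u) (r • (σ : E3))) * (starRingEnd ℂ) (mm1 k u r σ) ∂nu
     = - ∫ σ, bb k (Lg (skA j) u) r σ * (starRingEnd ℂ)
        (bb k (Lg (skA j) u) r σ + r * bb1 k (Lg (skA j) u) r σ) ∂nu := by
  have hI := contDiff_Lg (ContinuousLinearMap.id ℝ E3) hu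
  have hV : ContDiff ℝ (⊤ : ℕ∞) (fun x => (1 - Complex.I * k * r) * u x + Lg (ContinuousLinearMap.id ℝ E3) u x) :=
    (contDiff_const.mul hu).add hI
  have h := sph_parts j (contDiff_Lg (skA j) hu) hV r
  have hL : ∀ x, Lg (skA j) (fun x => (1 - Complex.I * k * r) * u x + Lg (ContinuousLinearMap.id ℝ E3) u x) x
      = (1 - Complex.I * k * r) * Lg (skA j) u x + Lg (ContinuousLinearMap.id ℝ E3) (Lg (skA j) u) x := by
    intro x
    rw [← Lg_comm _ hu]
    have d1 := (hu.differentiable (by simp)) x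
    have d2 := (hI.differentiable (by simp)) x
    have := ((d1.hasFDerivAt.const_mul (1 - Complex.I * k * r)).add d2.hasFDerivAt).fderiv
    unfold Lg at this ⊢
    erw [this]
    simp
  simp only [hL] at h
  have h' := congrArg (fun z => (cE k r * (starRingEnd ℂ) (cE k r)) * z) h
  simp only [mul_neg] at h'
  rw [← integral_const_mul, ← integral_const_mul] at h'
  refine Eq.trans ?_ (h'.trans ?_)
  · congr 1; ext σ
    simp only [mm1, Lg, ContinuousLinearMap.id_apply, map_smul, Complex.real_smul, map_mul]
    ring
  · congr 2; ext σ
    have e : Lg (ContinuousLinearMap.id ℝ E3) (Lg (skA j) u) (r • (σ : E3)) =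
       r * fderiv ℝ (Lg (skA j) u) (r • (σ : E3)) σ := by
      show fderiv ℝ (Lg (skA j) u) (r • (σ : E3)) (r • (σ : E3)) = _
      simp
    rw [e]
    simp only [bb, bb1, map_mul, map_add, map_sub, map_neg, map_one]
    ring

lemma pair2 (j : Fin 3) (hu : ContDiff ℝ (⊤ : ℕ∞) u) (r : ℝ) :
    ∫ σ, (cE k r * Lg (skA j) (Lg (skA j) u) (r • (σ : E3))) * (starRingEnd ℂ) (mm k u r σ) ∂nu
     = - (r * ∫ σ, bb k (Lg (skA j) u) r σ * (starRingEnd ℂ) (bb k (Lg (skA j) u) r σ) ∂nu) := by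
  have h := sph_parts j (contDiff_Lg (skA j) hu) hu r
  have h' := congrArg (fun z => (r * cE k r * (starRingEnd ℂ) (cE k r)) * z) h
  simp only [mul_neg] at h'
  rw [← integral_const_mul, ← integral_const_mul] at h'
  rw [← integral_const_mul]
  refine Eq.trans ?_ (h'.trans ?_)
  · congr 1; ext σ
    simp only [mm, map_mul, Complex.conj_ofReal]
    ring
  · congr 2; ext σ
    simp only [bb, map_mul]
    ring

end Mu2

open MeasureTheory Metric
namespace Mu2
open Set Filter Topology
open scoped Pointwise ENNReal NNReal

variable {k : ℂ} {u : E3 → ℂ}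

lemma pde_pair (hu : ContDiff ℝ (⊤ : ℕ∞) u) {g : E3 → ℂ} (hgs : ContDiff ℝ (⊤ : ℕ∞) g)
    (hg : ∀ x, Lap u x + k ^ 2 * u x = - g x) (r : ℝ) {w : ℝ → Sph → ℂ}
    (hw : Continuous (Function.uncurry w)) :
    r * SP (mm2 k u) w r + 2 * Complex.I * k * (r * SP (mm1 k u) w r)
      + ∑ j, ∫ σ, (cE k r * Lg (skA j) (Lg (skA j) u) (r • (σ : E3))) * (starRingEnd ℂ) (w r σ) ∂nu
      = - (r * SP (mm k g) w r) := by
  have c1 := (mm1_cont (k := k) hu).uncurry_left r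
  have c2 := (mm2_cont (k := k) hu).uncurry_left r
  have cg := (mm_cont (k := k) hgs).uncurry_left r
  have cw := hw.uncurry_left r
  have cL : ∀ j, Continuous (Lg (skA j) (Lg (skA j) u)) := fun j =>
    (contDiff_Lg _ (contDiff_Lg _ hu)).continuous
  have i2 : Integrable (fun σ => mm2 k u r σ * (starRingEnd ℂ) (w r σ)) nu := integrable_sph (by fun_prop)
  have i1 : Integrable (fun σ => mm1 k u r σ * (starRingEnd ℂ) (w r σ)) nu := integrable_sph (by fun_prop)
  have iL : ∀ j, Integrable (fun σ : Sph => (cE k r * Lg (skA j) (Lg (skA j) u) (r • (σ : E3))) * (starRingEnd ℂ) (w r σ)) nu :=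
    fun j => integrable_sph (by have := cL j; fun_prop)
  unfold SP
  rw [← integral_finsetSum _ fun j _ => iL j]
  simp only [← integral_const_mul, ← integral_neg]
  rw [← integral_add (i2.const_mul _) ((i1.const_mul _).const_mul _),
    ← integral_add (f := fun σ => _ + _) ((i2.const_mul _).add ((i1.const_mul _).const_mul _)) (integrable_finsetSum _ fun j _ => iL j)]
  congr 1; ext σ
  have h := ray_pde hu hg r σ
  rw [← Finset.sum_mul]
  linear_combination (starRingEnd ℂ (w r σ)) * h

lemma id1 (hu : ContDiff ℝ (⊤ : ℕ∞) u) {g : E3 → ℂ} (hgs : ContDiff ℝ (⊤ : ℕ∞) g)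
    (hg : ∀ x, Lap u x + k ^ 2 * u x = - g x) {r : ℝ} (hr : 0 < r) :
    2 * k.im * SN (mm1 k u) r - (SP (mm k g) (mm1 k u) r).re ≤
    (SP (mm2 k u) (mm1 k u) r).re - ∑ j, (SP (bb1 k (Lg (skA j) u)) (bb k (Lg (skA j) u)) r).re := by
  have h := pde_pair hu hgs hg r (mm1_cont (k := k) hu)
  have e : ∀ j, ∫ σ, (cE k r * Lg (skA j) (Lg (skA j) u) (r • (σ : E3))) * (starRingEnd ℂ) (mm1 k u r σ) ∂nu
      = - ((SN (bb k (Lg (skA j) u)) r : ℂ) + r * (starRingEnd ℂ) (SP (bb1 k (Lg (skA j) u)) (bb k (Lg (skA j) u)) r)) := by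
    intro j
    have hL := contDiff_Lg (skA j) hu
    have cb := (bb_cont (k := k) hL).uncurry_left r
    have cb1 := (bb1_cont (k := k) hL).uncurry_left r
    rw [pair1 j hu, ← SN_SP, ← SP_conj]
    unfold SP
    rw [← integral_const_mul, ← integral_add (integrable_sph (by fun_prop)) (integrable_sph (by fun_prop))]
    congr 2; ext σ
    simp only [map_add, map_mul, Complex.conj_ofReal]
    ring
  simp only [e] at h
  rw [SN_SP] at h
  have h2 := congrArg Complex.re h
  simp [Finset.sum_add_distrib, ← Finset.mul_sum] at h2
  have h3 : 0 ≤ ∑ j, SN (bb k (Lg (skA j) u)) r := Finset.sum_nonneg fun j _ => SN_nonneg _ _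
  refine le_of_mul_le_mul_left ?_ hr
  nlinarith

lemma id2 (hk : 0 < k.im) (hu : ContDiff ℝ (⊤ : ℕ∞) u) {g : E3 → ℂ} (hgs : ContDiff ℝ (⊤ : ℕ∞) g)
    (hg : ∀ x, Lap u x + k ^ 2 * u x = - g x) {r : ℝ} (hr : 0 < r) :
    ((SP (mm2 k u) (mm k u) r + SN (mm1 k u) r) / (Complex.I * k)).re + 2 * (SP (mm1 k u) (mm k u) r).re
      ≤ ‖SP (mm k g) (mm k u) r‖ / ‖k‖ := by
  have h := pde_pair hu hgs hg r (mm_cont (k := k) hu)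
  simp only [pair2 _ hu] at h
  have e : ∀ j, ∫ σ, bb k (Lg (skA j) u) r σ * (starRingEnd ℂ) (bb k (Lg (skA j) u) r σ) ∂nu = (SN (bb k (Lg (skA j) u)) r : ℂ) :=
    fun j => SN_SP _ _
  simp only [e] at h
  have hk0 : k ≠ 0 := by rintro rfl; simp at hk
  have hr0 : (r : ℂ) ≠ 0 := by exact_mod_cast hr.ne'
  set Q : ℝ := ∑ j, SN (bb k (Lg (skA j) u)) r with hQ
  have hQ0 : 0 ≤ Q := Finset.sum_nonneg fun j _ => SN_nonneg _ _
  have h1 : SP (mm2 k u) (mm k u) r = -2 * Complex.I * k * SP (mm1 k u) (mm k u) r + Q - SP (mm k g) (mm k u) r := by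
    rw [Finset.sum_neg_distrib, ← Finset.mul_sum] at h
    apply mul_left_cancel₀ hr0
    rw [hQ]; push_cast
    linear_combination h
  have h2 : (SP (mm2 k u) (mm k u) r + SN (mm1 k u) r) / (Complex.I * k) =
      -2 * SP (mm1 k u) (mm k u) r + ((Q + SN (mm1 k u) r : ℝ) : ℂ) * (Complex.I * k)⁻¹ - SP (mm k g) (mm k u) r / (Complex.I * k) := by
    rw [h1]
    push_cast
    have : Complex.I * k ≠ 0 := mul_ne_zero Complex.I_ne_zero hk0
    field_simp
    ring
  rw [h2]
  have h3 : (((Q + SN (mm1 k u) r : ℝ) : ℂ) * (Complex.I * k)⁻¹).re ≤ 0 := by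
    rw [Complex.re_ofReal_mul, Complex.inv_re]
    have : (Complex.I * k).re = - k.im := by simp
    rw [this]
    have h4 : 0 ≤ Q + SN (mm1 k u) r := add_nonneg hQ0 (SN_nonneg _ _)
    have h5 : -k.im / Complex.normSq (Complex.I * k) ≤ 0 :=
      div_nonpos_of_nonpos_of_nonneg (by linarith) (Complex.normSq_nonneg _)
    exact mul_nonpos_of_nonneg_of_nonpos h4 h5
  have h6 : -(SP (mm k g) (mm k u) r / (Complex.I * k)).re ≤ ‖SP (mm k g) (mm k u) r‖ / ‖k‖ := by
    have := (abs_le.1 (Complex.abs_re_le_norm (SP (mm k g) (mm k u) r / (Complex.I * k)))).1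
    rw [norm_div, norm_mul, Complex.norm_I, one_mul] at this
    linarith
  rw [Complex.sub_re, Complex.add_re]
  have : (-2 * SP (mm1 k u) (mm k u) r).re = -2 * (SP (mm1 k u) (mm k u) r).re := by simp
  rw [this]
  linarith

theorem ray_bound (hk : 0 < k.im) {g : E3 → ℂ} (hg : ContDiff ℝ (⊤ : ℕ∞) g) (hc : HasCompactSupport g)
    {W T : ℝ} (hW : ∀ R, 0 ≤ R → ∫ r in (0 : ℝ)..R, SN (mm k g) r ≤ W)
    (hT : ∀ R, 0 ≤ R → ∫ r in (0 : ℝ)..R, Real.sqrt (SN (mm k g) r) ≤ T) (R : ℝ) (hR : 0 ≤ R) :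
    Real.sqrt (SN (mm k (U k g)) R) ≤ 3 * Real.sqrt (W / (4 * k.im ^ 2) / ‖k‖) + T / ‖k‖ := by
  set u := U k g with hu_def
  have hu : ContDiff ℝ (⊤ : ℕ∞) u := contDiff_U hk hg hc
  have hpde : ∀ x, Lap u x + k ^ 2 * u x = - g x := U_eq hk hg hc
  have hL : ∀ j, ContDiff ℝ (⊤ : ℕ∞) (Lg (skA j) u) := fun j => contDiff_Lg (skA j) hu
  have hk0 : k ≠ 0 := by rintro rfl; simp at hk
  have c0 := mm_cont (k := k) hu
  have c1 := mm1_cont (k := k) hu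
  have c2 := mm2_cont (k := k) hu
  have cg := mm_cont (k := k) hg
  have cb : ∀ j, Continuous (Function.uncurry (bb k (Lg (skA j) u))) := fun j => bb_cont (hL j)
  have cb1 : ∀ j, Continuous (Function.uncurry (bb1 k (Lg (skA j) u))) := fun j => bb1_cont (hL j)
  obtain ⟨C, hC0, hC1, hC2⟩ := U_bounds hk hg hc
  obtain ⟨R1, hR1⟩ := hc.isCompact.isBounded.subset_closedBall (0 : E3)
  have sq : ∀ (a : ℝ → Sph → ℂ) r, Real.sqrt (SN a r) ^ 2 = SN a r := fun a r => Real.sq_sqrt (SN_nonneg a r)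
  have m0 : ∀ σ, mm k u 0 σ = 0 := by intro σ; simp [mm]
  have hΦ : ∀ r, HasDerivAt (fun r => (1 / 2 : ℝ) * (SN (mm1 k u) r - ∑ j, SN (bb k (Lg (skA j) u)) r))
      ((SP (mm2 k u) (mm1 k u) r).re - ∑ j, (SP (bb1 k (Lg (skA j) u)) (bb k (Lg (skA j) u)) r).re) r := by
    intro r
    have h1 := SN_deriv c1 c2 (fun σ r => mm1_deriv hu σ r) r
    have h2 := HasDerivAt.fun_sum (u := Finset.univ) fun j _ => SN_deriv (cb j) (cb1 j) (fun σ r => bb_deriv (hL j) σ r) r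
    refine ((h1.sub h2).const_mul (1 / 2 : ℝ)).congr_deriv ?_
    rw [← Finset.mul_sum]; ring
  have hΨ : ∀ r, HasDerivAt (fun r => (SP (mm1 k u) (mm k u) r / (Complex.I * k)).re + SN (mm k u) r)
      (((SP (mm2 k u) (mm k u) r + SN (mm1 k u) r) / (Complex.I * k)).re + 2 * (SP (mm1 k u) (mm k u) r).re) r := by
    intro r
    have h1 := SP_deriv c1 c0 c2 c1 (fun σ r => mm1_deriv hu σ r) (fun σ r => mm_deriv hu σ r) r
    rw [SN_SP] at h1
    have h2 := Complex.reCLM.hasFDerivAt.comp_hasDerivAt r (h1.div_const (Complex.I * k))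
    exact h2.add (SN_deriv c0 c1 (fun σ r => mm_deriv hu σ r) r)
  refine ode_bound (α := k.im) (κ := ‖k‖) (W := W) (T := T) (C := (4 * Real.pi) * ((2 + ‖k‖) * C) ^ 2) (R0 := max R1 0 + 1)
    (a := fun r => Real.sqrt (SN (mm1 k u) r)) (n := fun r => Real.sqrt (SN (mm k u) r))
    (p := fun r => Real.sqrt (SN (mm k g) r)) (N' := fun r => 2 * (SP (mm1 k u) (mm k u) r).re)
    hk (norm_pos_iff.2 hk0) (SN_cont c1).sqrt (SN_cont c0).sqrt (SN_cont cg).sqrt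
    (fun _ => Real.sqrt_nonneg _) (fun _ => Real.sqrt_nonneg _) (fun _ => Real.sqrt_nonneg _)
    hΦ ?_ ?_ ?_ (by positivity) ?_ ?_ ?_ ?_ ?_ hΨ ?_ ?_ ?_ ?_ hT R hR
  · intro r hr
    refine le_trans ?_ (id1 hu hg hpde hr)
    rw [sq]
    have := (Complex.re_le_norm (SP (mm k g) (mm1 k u) r)).trans (SP_le cg c1 r)
    linarith
  · have : ∀ j, SN (bb k (Lg (skA j) u)) 0 = 0 := by
      intro j
      have : ∀ σ, bb k (Lg (skA j) u) 0 σ = 0 := by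
        intro σ; simp [bb, Lg]
      simp [SN, this]
    simp only [this, Finset.sum_const_zero, sub_zero]
    have := SN_nonneg (mm1 k u) 0
    positivity
  · intro r
    rw [sq]
    have h3 : 0 ≤ ∑ j, SN (bb k (Lg (skA j) u)) r := Finset.sum_nonneg fun j _ => SN_nonneg _ _
    linarith
  · intro r hr
    have : ∀ σ, mm k g r σ = 0 := by
      intro σ
      have : g (r • (σ : E3)) = 0 := by
        by_contra hne
        have h1 := hR1 (subset_tsupport g hne)
        rw [mem_closedBall_zero_iff, norm_smul, norm_sph, mul_one, Real.norm_eq_abs] at h1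
        have := le_abs_self r
        have := le_max_left R1 0
        linarith
      simp [mm, this]
    simp [SN, this]
  · intro r hr
    rw [sq]
    have hb : ∀ σ, ‖mm1 k u r σ‖ ^ 2 ≤ ((2 + ‖k‖) * C) ^ 2 * (1 + r) ^ 2 * Real.exp (2 * k.im * r) := by
      intro σ
      have e : Real.exp (2 * k.im * r) = Real.exp (k.im * r) ^ 2 := by
        rw [← Real.exp_nat_mul]; congr 1; push_cast; ring
      rw [e, ← mul_pow, ← mul_pow]
      gcongr
      unfold mm1
      rw [norm_mul, cE_norm, mul_comm]
      gcongr
      refine (norm_add_le _ _).trans ?_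
      rw [norm_mul, norm_mul, Complex.norm_real, Real.norm_of_nonneg hr]
      have h1 : ‖(1 - Complex.I * k * r : ℂ)‖ ≤ 1 + ‖k‖ * r := by
        refine (norm_sub_le _ _).trans ?_
        simp [abs_of_nonneg hr]
      have h2 := hC2 (r • (σ : E3)) σ
      rw [norm_sph, mul_one] at h2
      calc _ ≤ (1 + ‖k‖ * r) * C + r * C := by gcongr; exact hC1 _
        _ ≤ _ := by nlinarith [norm_nonneg k, mul_nonneg (norm_nonneg k) hC0, mul_nonneg hr hC0]
    have h3 : SN (mm1 k u) r ≤ ∫ σ : Sph, ((2 + ‖k‖) * C) ^ 2 * (1 + r) ^ 2 * Real.exp (2 * k.im * r) ∂nu := by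
      have := c1.uncurry_left r
      exact integral_mono (integrable_sph (by fun_prop)) (integrable_const _) hb
    rw [integral_const, nu_univ, smul_eq_mul] at h3
    linarith
  · intro r
    simp only [sq]
    exact SN_deriv c0 c1 (fun σ r => mm_deriv hu σ r) r
  · intro r
    have := (Complex.re_le_norm (SP (mm1 k u) (mm k u) r)).trans (SP_le c1 c0 r)
    linarith
  · simp [SN, m0]
  · intro r hr
    refine (id2 hk hu hg hpde hr).trans ?_
    gcongr
    exact SP_le cg c0 r
  · simp [SN, SP, m0]
  · intro r
    rw [sq]
    have h1 := (abs_le.1 (Complex.abs_re_le_norm (SP (mm1 k u) (mm k u) r / (Complex.I * k)))).1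
    rw [norm_div, norm_mul, Complex.norm_I, one_mul] at h1
    have h2 : ‖SP (mm1 k u) (mm k u) r‖ / ‖k‖ ≤ Real.sqrt (SN (mm1 k u) r) * Real.sqrt (SN (mm k u) r) / ‖k‖ := by
      gcongr
      exact SP_le c1 c0 r
    linarith
  · simp only [sq]
    exact hW
end Mu2

open MeasureTheory Metric
namespace Mu2
open Set Filter Topology
open scoped Pointwise ENNReal NNReal

noncomputable def gg (k : ℂ) (f : E3 → ℂ) (y : E3) : ℂ :=
  Complex.exp (Complex.I * k * (‖y‖ : ℂ)) * f y / (‖y‖ : ℂ)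

lemma gg_contDiff (k : ℂ) {f : E3 → ℂ} (hf : ContDiff ℝ (⊤ : ℕ∞) f) (hz : f =ᶠ[𝓝 0] 0) :
    ContDiff ℝ (⊤ : ℕ∞) (gg k f) := by
  rw [contDiff_iff_contDiffAt]
  intro x
  by_cases hx : x = 0
  · subst hx
    refine (contDiffAt_const (c := (0 : ℂ))).congr_of_eventuallyEq ?_
    filter_upwards [hz] with y hy
    simp [gg, hy]
  · have hn : ContDiffAt ℝ (⊤ : ℕ∞) (fun y : E3 => (‖y‖ : ℂ)) x :=
      Complex.ofRealCLM.contDiff.contDiffAt.comp x (contDiffAt_norm ℝ hx)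
    unfold gg
    have hx' : (‖x‖ : ℂ) ≠ 0 := by simpa using hx
    simp only [div_eq_mul_inv]
    refine ContDiffAt.mul (ContDiffAt.mul ?_ hf.contDiffAt) (hn.inv hx')
    exact (contDiffAt_const.mul hn).cexp

lemma gg_compact (k : ℂ) {f : E3 → ℂ} (hc : HasCompactSupport f) : HasCompactSupport (gg k f) := by
  refine hc.mono fun x hx => ?_
  simp only [Function.mem_support, gg] at hx ⊢
  intro h; simp [h] at hx

lemma mu2_eq (k : ℂ) (f : E3 → ℂ) (r : ℝ) (σ : Sph) :
    mu2 k f r σ = mm k (U k (gg k f)) r σ := by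
  unfold mu2 mm U
  have h0 : ∫ y, G k y * gg k f (r • (σ : E3) - y) = ∫ y, G k (r • (σ : E3) - y) * gg k f y := by
    rw [← integral_sub_left_eq_self (fun y => G k y * gg k f (r • (σ : E3) - y)) volume (r • (σ : E3))]
    simp only [sub_sub_cancel]
  rw [h0]
  rw [mul_left_comm (cE k r), ← integral_const_mul (cE k r)]
  congr 1
  refine integral_congr_ae (.of_forall fun y => ?_)
  simp only
  unfold _root_.ker cE G gg
  have : Complex.exp (Complex.I * k * ((-r + ‖r • (σ : E3) - y‖ + ‖y‖ : ℝ) : ℂ)) =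
      Complex.exp (-(Complex.I * k) * (r : ℂ)) * Complex.exp (Complex.I * k * (‖r • (σ : E3) - y‖ : ℂ)) *
      Complex.exp (Complex.I * k * (‖y‖ : ℂ)) := by
    rw [← Complex.exp_add, ← Complex.exp_add]; congr 1; push_cast; ring
  rw [this]
  push_cast
  simp only [div_eq_mul_inv, mul_inv]
  ring

lemma mm_gg (k : ℂ) (f : E3 → ℂ) {r : ℝ} (hr : 0 < r) (σ : Sph) :
    mm k (gg k f) r σ = f (r • (σ : E3)) := by
  unfold mm gg cE
  have hn : ‖r • (σ : E3)‖ = r := by rw [norm_smul, norm_sph, mul_one, Real.norm_of_nonneg hr.le]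
  rw [hn]
  have hr0 : (r : ℂ) ≠ 0 := by exact_mod_cast hr.ne'
  have : Complex.exp (-(Complex.I * k) * (r : ℂ)) * Complex.exp (Complex.I * k * (r : ℂ)) = 1 := by
    rw [← Complex.exp_add]; simp
  field_simp
  rw [neg_mul] at this
  linear_combination (f (r • (σ : E3))) * this

lemma wt_nonneg (x : E3) : 0 ≤ wt x := by unfold wt; split_ifs <;> positivity

lemma wt_meas : Measurable wt := by
  unfold wt
  exact Measurable.ite (measurableSet_lt measurable_const measurable_norm) measurable_const (by fun_prop)

lemma wt_integrable {f : E3 → ℂ} (hf : Continuous f) (hc : HasCompactSupport f) :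
    Integrable (fun x => ‖f x‖ ^ 2 * wt x) := by
  obtain ⟨B, hB⟩ := hf.bounded_above_of_compact_support hc
  obtain ⟨R1, hR1⟩ := hc.isCompact.isBounded.subset_closedBall (0 : E3)
  set R := max R1 1 with hR
  have hB0 : 0 ≤ B := (norm_nonneg _).trans (hB 0)
  set F : ℝ → ℝ := (Iic R).indicator (fun r => B ^ 2 * (if 1 < r then 1 else (r ^ 2)⁻¹)) with hF
  have hmF : Measurable F := by
    refine Measurable.indicator ?_ measurableSet_Iic
    exact measurable_const.mul (Measurable.ite (measurableSet_lt measurable_const measurable_id) measurable_const (by fun_prop))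
  have hi : Integrable (fun x : E3 => F ‖x‖) := by
    rw [integrable_fun_norm_addHaar]
    have hfr : Module.finrank ℝ E3 = 3 := by simp
    rw [hfr]
    have : IntegrableOn (fun _ : ℝ => R ^ 2 * B ^ 2) (Ioc 0 R) := continuous_const.integrableOn_Ioc
    have h2 : Integrable ((Ioc 0 R).indicator (fun _ : ℝ => R ^ 2 * B ^ 2)) :=
      this.integrable_indicator measurableSet_Ioc
    refine Integrable.mono' (h2.integrableOn) (by fun_prop) ?_
    refine (ae_restrict_mem measurableSet_Ioi).mono fun r hr => ?_
    have hr : 0 < r := hr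
    simp only [hF, indicator, mem_Iic, mem_Ioc, hr, true_and, smul_eq_mul]
    split_ifs with h1 h2
    · rw [Real.norm_of_nonneg (by positivity), mul_one]
      norm_num
      gcongr
    · rw [Real.norm_of_nonneg (by positivity)]
      norm_num
      have e : r ^ 2 * (B ^ 2 * (r ^ 2)⁻¹) = 1 ^ 2 * B ^ 2 := by field_simp
      rw [e]
      gcongr
      exact le_max_right _ _
    · simp
  refine hi.mono' (((hf.norm.pow 2).measurable.mul wt_meas).aestronglyMeasurable) (.of_forall fun x => ?_)
  rw [Real.norm_of_nonneg (mul_nonneg (by positivity) (wt_nonneg x))]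
  simp only [hF, indicator, mem_Iic]
  by_cases h1 : ‖x‖ ≤ R
  · rw [if_pos h1]
    unfold wt
    have : ‖f x‖ ^ 2 ≤ B ^ 2 := by gcongr; exact hB x
    split_ifs <;> gcongr
  · rw [if_neg h1]
    have : f x = 0 := by
      by_contra hne
      have h2 := hR1 (subset_tsupport f hne)
      rw [mem_closedBall_zero_iff] at h2
      exact h1 (h2.trans (le_max_left _ _))
    simp [this]

lemma SN_weight {k : ℂ} {f : E3 → ℂ} (hf : ContDiff ℝ (⊤ : ℕ∞) f) (hc : HasCompactSupport f) (hz : f =ᶠ[𝓝 0] 0)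
    {R : ℝ} (hR : 0 ≤ R) :
    ∫ r in (0 : ℝ)..R, (1 + r ^ 2) / 2 * SN (mm k (gg k f)) r ≤ ∫ x, ‖f x‖ ^ 2 * wt x ∧
    ∫ r in (0 : ℝ)..R, SN (mm k (gg k f)) r ≤ ∫ x, ‖f x‖ ^ 2 * wt x := by
  have hg := gg_contDiff k hf hz
  have cS : Continuous (SN (mm k (gg k f))) := SN_cont (mm_cont hg)
  obtain ⟨h1, h2⟩ := polar_integral (wt_integrable hf.continuous hc)
  have e : ∀ r ∈ Ioi (0 : ℝ), r ^ 2 • ∫ σ : Sph, ‖f (r • (σ : E3))‖ ^ 2 * wt (r • (σ : E3)) ∂nu =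
      (if 1 < r then r ^ 2 else 1) * SN (mm k (gg k f)) r := by
    intro r hr
    have hr : 0 < r := hr
    have hn : ∀ σ : Sph, ‖r • (σ : E3)‖ = r := fun σ => by
      rw [norm_smul, norm_sph, mul_one, Real.norm_of_nonneg hr.le]
    simp only [wt, hn, integral_mul_const, SN, mm_gg k f hr, smul_eq_mul]
    split_ifs with h
    · ring
    · field_simp
  rw [h2, setIntegral_congr_fun measurableSet_Ioi e]
  have h3 := h1.congr_fun e measurableSet_Ioi
  have key : ∀ q : ℝ → ℝ, Continuous q → (∀ r, 0 < r → q r ≤ if 1 < r then r ^ 2 else 1) →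
      ∫ r in (0 : ℝ)..R, q r * SN (mm k (gg k f)) r ≤ ∫ r in Ioi (0 : ℝ), (if 1 < r then r ^ 2 else 1) * SN (mm k (gg k f)) r := by
    intro q cq hq
    rw [intervalIntegral.integral_of_le hR]
    have hsub : Ioc 0 R ⊆ Ioi (0 : ℝ) := Ioc_subset_Ioi_self
    refine le_trans (setIntegral_mono_on ((cq.mul cS).integrableOn_Ioc) (h3.mono_set hsub) measurableSet_Ioc
      fun r hr => ?_) (setIntegral_mono_set h3 ?_ hsub.eventuallyLE)
    · exact mul_le_mul_of_nonneg_right (hq r hr.1) (SN_nonneg _ _)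
    · refine .of_forall fun r => ?_
      have := SN_nonneg (mm k (gg k f)) r
      simp only [Pi.zero_apply]
      split_ifs <;> positivity
  refine ⟨key (fun r => (1 + r ^ 2) / 2) (by fun_prop) ?_, ?_⟩
  · intro r hr
    split_ifs with h <;> nlinarith
  · have := key (fun _ => 1) (by fun_prop) (fun r hr => by split_ifs with h <;> nlinarith)
    simpa using this

lemma main0 {k : ℂ} (hk : 0 < k.im) {f : E3 → ℂ} (hf : ContDiff ℝ (⊤ : ℕ∞) f) (hc : HasCompactSupport f)
    (hz : f =ᶠ[𝓝 0] 0) {R : ℝ} (hR : 0 < R) :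
    Continuous (fun σ : Sph => mu2 k f R σ) ∧
    ∫ σ : Sph, ‖mu2 k f R σ‖ ^ 2 ∂nu ≤ 8 * (1 / ‖k‖ ^ 2 + 1 / (‖k‖ * k.im ^ 2)) * ∫ x, ‖f x‖ ^ 2 * wt x := by
  have hg := gg_contDiff k hf hz
  have hgc := gg_compact k hc
  have cS : Continuous (SN (mm k (gg k f))) := SN_cont (mm_cont hg)
  set I := ∫ x, ‖f x‖ ^ 2 * wt x with hI
  have hI0 : 0 ≤ I := integral_nonneg fun x => mul_nonneg (by positivity) (wt_nonneg x)
  have hk0 : 0 < ‖k‖ := norm_pos_iff.2 (by rintro rfl; simp at hk)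
  have hT : ∀ R, 0 ≤ R → ∫ r in (0 : ℝ)..R, Real.sqrt (SN (mm k (gg k f)) r) ≤ Real.sqrt (Real.pi * I) := by
    intro R hR
    have cq : Continuous fun r : ℝ => (Real.sqrt (1 + r ^ 2))⁻¹ := by
      refine Continuous.inv₀ (by fun_prop) fun r => ?_
      positivity
    have hq : ∀ r : ℝ, 0 ≤ 1 + r ^ 2 := fun r => by positivity
    have := cs_int (volume.restrict (Ioc 0 R)) (f := fun r => Real.sqrt ((1 + r ^ 2) * SN (mm k (gg k f)) r))
      (g := fun r => (Real.sqrt (1 + r ^ 2))⁻¹)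
      (Continuous.integrableOn_Ioc (by fun_prop)) (Continuous.integrableOn_Ioc (by fun_prop))
      (Continuous.integrableOn_Ioc (by fun_prop))
    have e1 : ∀ r, Real.sqrt ((1 + r ^ 2) * SN (mm k (gg k f)) r) ^ 2 = 2 * ((1 + r ^ 2) / 2 * SN (mm k (gg k f)) r) := by
      intro r
      rw [Real.sq_sqrt (mul_nonneg (hq r) (SN_nonneg _ _))]; ring
    have e2 : ∀ r : ℝ, (Real.sqrt (1 + r ^ 2))⁻¹ ^ 2 = (1 + r ^ 2)⁻¹ := by
      intro r
      rw [inv_pow, Real.sq_sqrt (hq r)]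
    have e3 : ∀ r, Real.sqrt ((1 + r ^ 2) * SN (mm k (gg k f)) r) * (Real.sqrt (1 + r ^ 2))⁻¹ = Real.sqrt (SN (mm k (gg k f)) r) := by
      intro r
      rw [Real.sqrt_mul (hq r)]
      have : Real.sqrt (1 + r ^ 2) ≠ 0 := by positivity
      field_simp
    simp only [e1, e2, e3] at this
    rw [← intervalIntegral.integral_of_le hR, ← intervalIntegral.integral_of_le hR, ← intervalIntegral.integral_of_le hR,
      integral_inv_one_add_sq, Real.arctan_zero, sub_zero, intervalIntegral.integral_const_mul] at this
    refine Real.le_sqrt_of_sq_le (this.trans ?_)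
    have h1 := (SN_weight (k := k) hf hc hz hR).1
    have h2 := (Real.arctan_lt_pi_div_two R).le
    have h3 : 0 ≤ Real.arctan R := by rw [← Real.arctan_zero]; exact Real.arctan_le_arctan_iff.2 hR
    calc _ ≤ 2 * I * (Real.pi / 2) := by gcongr
      _ = _ := by ring
  have hb := ray_bound hk hg hgc (fun R hR => (SN_weight (k := k) hf hc hz hR).2) hT R hR.le
  have e : ∀ σ : Sph, mu2 k f R σ = mm k (U k (gg k f)) R σ := mu2_eq k f R
  simp only [e]
  refine ⟨(mm_cont (contDiff_U hk hg hgc)).uncurry_left R, ?_⟩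
  change SN (mm k (U k (gg k f))) R ≤ _
  rw [← Real.sq_sqrt (SN_nonneg (mm k (U k (gg k f))) R)]
  refine (pow_le_pow_left₀ (Real.sqrt_nonneg _) hb 2).trans ?_
  rw [← hI]
  set s := Real.sqrt (I / (4 * k.im ^ 2) / ‖k‖) with hs
  set t := Real.sqrt (Real.pi * I) with ht
  have hs2 : s ^ 2 = I / (4 * k.im ^ 2) / ‖k‖ := Real.sq_sqrt (by positivity)
  have ht2 : t ^ 2 = Real.pi * I := Real.sq_sqrt (by positivity)
  have h1 : (3 * s + t / ‖k‖) ^ 2 ≤ 18 * s ^ 2 + 2 * (t ^ 2 / ‖k‖ ^ 2) := by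
    rw [← div_pow]
    nlinarith [sq_nonneg (3 * s - t / ‖k‖)]
  refine h1.trans ?_
  rw [hs2, ht2]
  have h2 : 0 ≤ I / (‖k‖ * k.im ^ 2) := by positivity
  have h3 : Real.pi * I / ‖k‖ ^ 2 ≤ 4 * (I / ‖k‖ ^ 2) := by
    rw [mul_div_assoc]
    have := Real.pi_le_four
    gcongr
  have e1 : 8 * (1 / ‖k‖ ^ 2 + 1 / (‖k‖ * k.im ^ 2)) * I = 8 * (I / ‖k‖ ^ 2) + 8 * (I / (‖k‖ * k.im ^ 2)) := by ring
  have e2 : 18 * (I / (4 * k.im ^ 2) / ‖k‖) = 4.5 * (I / (‖k‖ * k.im ^ 2)) := by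
    field_simp; ring
  rw [e1, e2]
  linarith
end Mu2

open MeasureTheory Metric
namespace Mu2
open Set Filter Topology
open scoped Pointwise ENNReal NNReal

noncomputable def insv (i : Fin 3) (s : ℝ) (b : Fin 2 → ℝ) : E3 :=
  WithLp.toLp 2 (Fin.insertNth (α := fun _ => ℝ) i s b : Fin 3 → ℝ)

lemma insv_self (i : Fin 3) (s : ℝ) (b : Fin 2 → ℝ) : insv i s b i = s := by
  simp [insv]

lemma insv_succ (i : Fin 3) (s : ℝ) (b : Fin 2 → ℝ) (j : Fin 2) : insv i s b (i.succAbove j) = b j := by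
  simp [insv]

lemma insv_ext {i : Fin 3} {x y : E3} (h0 : x i = y i) (h : ∀ j : Fin 2, x (i.succAbove j) = y (i.succAbove j)) :
    x = y := by
  ext l
  rcases Fin.eq_self_or_eq_succAbove i l with rfl | ⟨j, rfl⟩
  · exact h0
  · exact h j

lemma insv_dist (i : Fin 3) (s : ℝ) (b c : Fin 2 → ℝ) : ‖insv i s b - insv i s c‖ ≤ 2 * ‖b - c‖ := by
  have h : ‖insv i s b - insv i s c‖ ^ 2 ≤ (2 * ‖b - c‖) ^ 2 := by
    rw [EuclideanSpace.norm_sq_eq, Fin.sum_univ_succAbove _ i]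
    have h0 : (insv i s b - insv i s c) i = 0 := by
      rw [PiLp.sub_apply, insv_self, insv_self, sub_self]
    have h1 : ∀ j : Fin 2, (insv i s b - insv i s c) (i.succAbove j) = (b - c) j := by
      intro j
      rw [PiLp.sub_apply, insv_succ, insv_succ, Pi.sub_apply]
    rw [h0]
    simp only [h1, Fin.sum_univ_two]
    have a0 := norm_le_pi_norm (b - c) 0
    have a1 := norm_le_pi_norm (b - c) 1
    have n0 := norm_nonneg ((b - c) 0)
    have n1 := norm_nonneg ((b - c) 1)
    simp only [norm_zero]
    nlinarith
  exact (sq_le_sq₀ (norm_nonneg _) (by positivity)).1 h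

lemma insv_norm {i : Fin 3} {s : ℝ} (hs : s ^ 2 = 1) (b : Fin 2 → ℝ) : 1 ≤ ‖insv i s b‖ := by
  have h : (1 : ℝ) ^ 2 ≤ ‖insv i s b‖ ^ 2 := by
    rw [EuclideanSpace.norm_sq_eq, Fin.sum_univ_succAbove _ i, insv_self]
    have : 0 ≤ ∑ j : Fin 2, ‖insv i s b (i.succAbove j)‖ ^ 2 := Finset.sum_nonneg fun _ _ => by positivity
    rw [Real.norm_eq_abs, sq_abs, hs]
    linarith
  exact (sq_le_sq₀ (by norm_num) (norm_nonneg _)).1 h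

noncomputable def psi (i : Fin 3) (s : ℝ) (b : Fin 2 → ℝ) : E3 := ‖insv i s b‖⁻¹ • insv i s b

lemma norm_proj {x y : E3} (hx : 1 ≤ ‖x‖) (hy : 1 ≤ ‖y‖) :
    ‖‖x‖⁻¹ • x - ‖y‖⁻¹ • y‖ ≤ 2 * ‖x - y‖ := by
  have hx0 : 0 < ‖x‖ := by linarith
  have hy0 : 0 < ‖y‖ := by linarith
  have e : ‖x‖⁻¹ • x - ‖y‖⁻¹ • y = ‖x‖⁻¹ • ((x - y) + ((‖y‖ - ‖x‖) * ‖y‖⁻¹) • y) := by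
    rw [smul_add, smul_sub, smul_smul]
    have : ‖x‖⁻¹ * ((‖y‖ - ‖x‖) * ‖y‖⁻¹) = ‖x‖⁻¹ - ‖y‖⁻¹ := by field_simp
    rw [this, sub_smul]; abel
  rw [e, norm_smul, norm_inv, norm_norm]
  have h1 : ‖(x - y) + ((‖y‖ - ‖x‖) * ‖y‖⁻¹) • y‖ ≤ 2 * ‖x - y‖ := by
    refine (norm_add_le _ _).trans ?_
    rw [norm_smul, norm_mul, norm_inv, norm_norm, mul_assoc, inv_mul_cancel₀ hy0.ne', mul_one, Real.norm_eq_abs]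
    have := abs_norm_sub_norm_le y x
    rw [norm_sub_rev] at this
    linarith
  have h2 : ‖x‖⁻¹ ≤ 1 := inv_le_one_of_one_le₀ hx
  calc _ ≤ 1 * (2 * ‖x - y‖) := by gcongr
    _ = _ := one_mul _

lemma psi_lip (i : Fin 3) {s : ℝ} (hs : s ^ 2 = 1) : LipschitzWith 4 (psi i s) := by
  refine LipschitzWith.of_dist_le_mul fun b c => ?_
  rw [dist_eq_norm, dist_eq_norm]
  refine (norm_proj (insv_norm hs b) (insv_norm hs c)).trans ?_
  have := insv_dist i s b c
  push_cast
  linarith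

noncomputable def spl (i : Fin 3) (x : E3) : ℝ × (Fin 2 → ℝ) := (x i, fun j => x (i.succAbove j))

lemma spl_pres (i : Fin 3) : MeasurePreserving (spl i) := by
  have := (volume_preserving_piFinSuccAbove (fun _ : Fin 3 => ℝ) i).comp (PiLp.volume_preserving_ofLp (Fin 3))
  exact this

/-- One patch of the comparison. -/
lemma patch (i : Fin 3) {s : ℝ} (hs : s ^ 2 = 1) {A : Set E3} (hA : MeasurableSet A) (hAs : A ⊆ Sph)
    (hp : ∀ x ∈ A, 1 / 2 ≤ s * x i) : μH[2] A ≤ 1024 * nu (Subtype.val ⁻¹' A) := by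
  set B := psi i s ⁻¹' A with hB
  have hBm : MeasurableSet B := (psi_lip i hs).continuous.measurable hA
  have himg : A ⊆ psi i s '' B := by
    intro x hx
    have hp' := hp x hx
    have hx1 : ‖x‖ = 1 := by simpa using hAs hx
    have hpos : 0 < s * x i := by linarith
    have hne : s * x i ≠ 0 := hpos.ne'
    have hins : insv i s (fun j => (s * x i)⁻¹ * x (i.succAbove j)) = (s * x i)⁻¹ • x := by
      refine insv_ext (i := i) ?_ fun j => ?_
      · rw [insv_self, PiLp.smul_apply, smul_eq_mul, eq_inv_mul_iff_mul_eq₀ hne]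
        linear_combination (x i) * hs
      · rw [insv_succ, PiLp.smul_apply, smul_eq_mul]
    have hpsi : psi i s (fun j => (s * x i)⁻¹ * x (i.succAbove j)) = x := by
      unfold psi
      rw [hins, norm_smul, hx1, mul_one, norm_inv, Real.norm_of_nonneg hpos.le, smul_smul, inv_inv,
        mul_inv_cancel₀ hne, one_smul]
    exact ⟨_, by rw [hB, mem_preimage, hpsi]; exact hx, hpsi⟩
  have h1 : μH[2] A ≤ 16 * volume B := by
    refine (measure_mono himg).trans (((psi_lip i hs).hausdorffMeasure_image_le (d := 2) (by norm_num) B).trans ?_)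
    have hv : (μH[2] : Measure (Fin 2 → ℝ)) = volume := by
      have := hausdorffMeasure_pi_real (ι := Fin 2)
      simpa using this
    rw [hv]
    gcongr
    norm_num
  set Q : Set (ℝ × (Fin 2 → ℝ)) := {p | 1 / 2 < s * p.1 ∧ s * p.1 < 1 ∧ (s * p.1)⁻¹ • p.2 ∈ B} with hQ
  have hQm : MeasurableSet Q := by
    have hm : Measurable fun p : ℝ × (Fin 2 → ℝ) => s * p.1 := by fun_prop
    refine (measurableSet_lt measurable_const hm).inter
      ((measurableSet_lt hm measurable_const).inter ?_)
    have : Measurable fun p : ℝ × (Fin 2 → ℝ) => (s * p.1)⁻¹ • p.2 := by fun_prop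
    exact this hBm
  have hs0 : s ≠ 0 := by rintro rfl; norm_num at hs
  have hsabs : |s| = 1 := by
    rw [← sq_eq_sq₀ (abs_nonneg s) (by norm_num), sq_abs, hs]; norm_num
  have h2 : volume B ≤ 8 * volume Q := by
    rw [Measure.volume_eq_prod, Measure.prod_apply hQm]
    set J : Set ℝ := (fun τ => s * τ) ⁻¹' Ioo (1 / 2) 1 with hJ
    have hJm : MeasurableSet J := (by fun_prop : Measurable fun τ => s * τ) measurableSet_Ioo
    have hJv : volume J = ENNReal.ofReal (1 / 2) := by
      rw [hJ, Real.volume_preimage_mul_left hs0, abs_inv, hsabs, Real.volume_Ioo]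
      norm_num
    have h3 : ∫⁻ τ in J, ENNReal.ofReal (1 / 4) * volume B ≤ ∫⁻ τ, volume (Prod.mk τ ⁻¹' Q) := by
      refine le_trans (setLIntegral_mono' hJm fun τ hτ => ?_) (setLIntegral_le_lintegral J _)
      have hτ1 : 1 / 2 < s * τ := hτ.1
      have hτ2 : s * τ < 1 := hτ.2
      have e : Prod.mk τ ⁻¹' Q = ((s * τ)⁻¹ • ·) ⁻¹' B := by
        ext z
        simp [hQ, hτ2]
        intro _
        linarith
      rw [e, Measure.addHaar_preimage_smul volume (inv_ne_zero (by linarith))]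
      gcongr
      rw [inv_pow, inv_inv]
      simp only [Module.finrank_fintype_fun_eq_card, Fintype.card_fin]
      rw [abs_of_nonneg (by positivity)]
      nlinarith
    rw [setLIntegral_const, hJv] at h3
    calc volume B = 8 * (ENNReal.ofReal (1 / 4) * volume B * ENNReal.ofReal (1 / 2)) := by
          rw [mul_right_comm, ← ENNReal.ofReal_mul (by norm_num), ← mul_assoc,
            show (8 : ℝ≥0∞) = ENNReal.ofReal 8 by simp, ← ENNReal.ofReal_mul (by norm_num)]
          norm_num
      _ ≤ _ := by gcongr
  have h4 : volume Q ≤ 8 * nu (Subtype.val ⁻¹' A) := by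
    have hval : (Subtype.val '' (Subtype.val ⁻¹' A : Set Sph) : Set E3) = A := by
      rw [Subtype.image_preimage_coe]
      exact inter_eq_right.2 hAs
    have hnu : nu (Subtype.val ⁻¹' A) = 3 * volume (Ioo (0 : ℝ) 1 • A) := by
      unfold nu
      rw [Measure.toSphere_apply' _ (measurable_subtype_coe hA), hval]
      simp
    rw [← (spl_pres i).measure_preimage hQm.nullMeasurableSet]
    have hsub : spl i ⁻¹' Q ⊆ (2 : ℝ) • (Ioo (0 : ℝ) 1 • A) := by
      rintro x ⟨hx1, hx2, hx3⟩
      simp only [spl] at hx1 hx2 hx3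
      have hpos : 0 < s * x i := by linarith
      have hne : s * x i ≠ 0 := hpos.ne'
      have hins : insv i s ((s * x i)⁻¹ • fun j => x (i.succAbove j)) = (s * x i)⁻¹ • x := by
        refine insv_ext (i := i) ?_ fun j => ?_
        · rw [insv_self, PiLp.smul_apply, smul_eq_mul, eq_inv_mul_iff_mul_eq₀ hne]
          linear_combination (x i) * hs
        · rw [insv_succ, PiLp.smul_apply, Pi.smul_apply]
      have hx0 : x ≠ 0 := by rintro rfl; simp at hne
      have hxn : 0 < ‖x‖ := norm_pos_iff.2 hx0
      have hpsi : psi i s ((s * x i)⁻¹ • fun j => x (i.succAbove j)) = ‖x‖⁻¹ • x := by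
        unfold psi
        rw [hins, norm_smul, norm_inv, Real.norm_of_nonneg hpos.le, smul_smul, mul_inv, inv_inv]
        have hxi : x i ≠ 0 := right_ne_zero_of_mul hne
        congr 1
        field_simp
      rw [hB, mem_preimage, hpsi] at hx3
      have hb := hp _ hx3
      rw [PiLp.smul_apply, smul_eq_mul] at hb
      have hlt : ‖x‖ < 2 := by
        have e : s * (‖x‖⁻¹ * x i) = (s * x i) / ‖x‖ := by ring
        rw [e, le_div_iff₀ hxn] at hb
        linarith
      refine ⟨(‖x‖ / 2) • (‖x‖⁻¹ • x), ⟨‖x‖ / 2, ⟨by positivity, by linarith⟩, _, hx3, rfl⟩, ?_⟩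
      simp only [smul_smul]
      have : 2 * (‖x‖ / 2 * ‖x‖⁻¹) = 1 := by field_simp
      rw [this, one_smul]
    refine (measure_mono hsub).trans ?_
    rw [Measure.addHaar_smul, hnu, ← mul_assoc]
    gcongr
    have : Module.finrank ℝ E3 = 3 := by simp
    rw [this]
    norm_num
  calc μH[2] A ≤ 16 * (8 * (8 * nu (Subtype.val ⁻¹' A))) := by
        refine h1.trans ?_
        gcongr
        refine h2.trans ?_
        gcongr
    _ = _ := by rw [← mul_assoc, ← mul_assoc]; norm_num

lemma patch_cover (x : E3) (hx : ‖x‖ = 1) : ∃ i : Fin 3, ∃ b : Bool, 1 / 2 ≤ (if b then (1 : ℝ) else -1) * x i := by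
  by_contra hcon
  push Not at hcon
  have h : ∀ i, x i ^ 2 < 1 / 4 := by
    intro i
    have h1 := hcon i true
    have h2 := hcon i false
    simp only [if_true, Bool.false_eq_true, if_false] at h1 h2
    nlinarith
  have h2 : ‖x‖ ^ 2 = 1 := by rw [hx]; norm_num
  rw [EuclideanSpace.norm_sq_eq, Fin.sum_univ_three] at h2
  simp only [Real.norm_eq_abs, sq_abs] at h2
  linarith [h 0, h 1, h 2]

lemma sphere_measure_le :
    (μH[2] : Measure E3).restrict Sph ≤ (6144 : ℝ≥0∞) • nu.map Subtype.val := by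
  refine Measure.le_iff.2 fun A hA => ?_
  rw [Measure.restrict_apply hA, Measure.smul_apply, Measure.map_apply measurable_subtype_coe hA, smul_eq_mul]
  set P : Fin 3 × Bool → Set E3 := fun q => (A ∩ Sph) ∩ {x | 1 / 2 ≤ (if q.2 then (1 : ℝ) else -1) * x q.1} with hP
  have hcov : A ∩ Sph ⊆ ⋃ q, P q := by
    intro x hx
    obtain ⟨i, b, h⟩ := patch_cover x (by simpa using hx.2)
    exact mem_iUnion.2 ⟨(i, b), hx, h⟩
  have hS : MeasurableSet (Sph : Set E3) := isClosed_sphere.measurableSet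
  have hb : ∀ q, μH[2] (P q) ≤ 1024 * nu (Subtype.val ⁻¹' A) := by
    rintro ⟨i, b⟩
    have hs : (if b then (1 : ℝ) else -1) ^ 2 = 1 := by cases b <;> norm_num
    refine (patch i hs (A := P (i, b)) ?_ (fun x hx => hx.1.2) (fun x hx => hx.2)).trans ?_
    · exact (hA.inter hS).inter (measurableSet_le measurable_const (by fun_prop))
    · gcongr
      exact fun x hx => hx.1.1
  calc μH[2] (A ∩ Sph) ≤ ∑ q, μH[2] (P q) := (measure_mono hcov).trans (measure_iUnion_fintype_le _ _)
    _ ≤ ∑ q : Fin 3 × Bool, 1024 * nu (Subtype.val ⁻¹' A) := Finset.sum_le_sum fun q _ => hb q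
    _ = _ := by
      rw [Finset.sum_const, nsmul_eq_mul, ← mul_assoc]
      simp
      norm_num
end Mu2

open MeasureTheory Metric
namespace Mu2
open Set Filter Topology
open scoped Pointwise ENNReal NNReal

noncomputable def chi (n : ℕ) (x : E3) : ℝ := Real.smoothTransition ((n : ℝ) * ‖x‖ ^ 2 - 1)

lemma chi_nonneg (n : ℕ) (x : E3) : 0 ≤ chi n x := Real.smoothTransition.nonneg _

lemma chi_le_one (n : ℕ) (x : E3) : chi n x ≤ 1 := Real.smoothTransition.le_one _

lemma chi_smooth (n : ℕ) : ContDiff ℝ (⊤ : ℕ∞) (chi n) :=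
  Real.smoothTransition.contDiff.comp ((contDiff_const.mul (contDiff_norm_sq ℝ)).sub contDiff_const)

lemma chi_zero (n : ℕ) : chi n =ᶠ[𝓝 0] 0 := by
  have h : Tendsto (fun x : E3 => (n : ℝ) * ‖x‖ ^ 2 - 1) (𝓝 0) (𝓝 ((n : ℝ) * ‖(0 : E3)‖ ^ 2 - 1)) := by
    have : Continuous (fun x : E3 => (n : ℝ) * ‖x‖ ^ 2 - 1) := by fun_prop
    exact this.tendsto 0
  have h0 : (n : ℝ) * ‖(0 : E3)‖ ^ 2 - 1 < 0 := by simp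
  filter_upwards [h.eventually_lt_const h0] with x hx
  exact Real.smoothTransition.zero_of_nonpos hx.le

lemma chi_tendsto {x : E3} (hx : x ≠ 0) : Tendsto (fun n => chi n x) atTop (𝓝 1) := by
  have h : Tendsto (fun n : ℕ => (n : ℝ) * ‖x‖ ^ 2) atTop atTop :=
    tendsto_natCast_atTop_atTop.atTop_mul_const (by positivity)
  refine tendsto_const_nhds.congr' ?_
  filter_upwards [h.eventually_ge_atTop 2] with n hn
  exact (Real.smoothTransition.one_of_one_le (by linarith)).symm

noncomputable def fa (f : E3 → ℂ) (n : ℕ) (x : E3) : ℂ := (chi n x : ℂ) * f x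

lemma fa_le (f : E3 → ℂ) (n : ℕ) (x : E3) : ‖fa f n x‖ ≤ ‖f x‖ := by
  unfold fa
  rw [norm_mul, Complex.norm_real, Real.norm_of_nonneg (chi_nonneg n x)]
  exact mul_le_of_le_one_left (norm_nonneg _) (chi_le_one n x)

lemma mu2_lim (k : ℂ) {f : E3 → ℂ} (r : ℝ) (σ : E3) (hi : Integrable fun y => _root_.ker k r σ y * f y)
    (hf : Continuous f) :
    Tendsto (fun n => mu2 k (fa f n) r σ) atTop (𝓝 (mu2 k f r σ)) := by
  unfold mu2
  refine Tendsto.const_mul _ ?_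
  refine tendsto_integral_of_dominated_convergence (fun y => ‖_root_.ker k r σ y * f y‖) ?_ hi.norm ?_ ?_
  · intro n
    have hc : Continuous fun y => (chi n y : ℂ) :=
      Complex.continuous_ofReal.comp (chi_smooth n).continuous
    refine (hc.aestronglyMeasurable.mul hi.aestronglyMeasurable).congr (.of_forall fun y => ?_)
    simp only [Pi.mul_apply, fa]
    ring
  · intro n
    refine .of_forall fun y => ?_
    rw [norm_mul, norm_mul]
    exact mul_le_mul_of_nonneg_left (fa_le f n y) (norm_nonneg _)
  · refine .of_forall fun y => ?_
    by_cases hy : y = 0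
    · subst hy
      simp [_root_.ker]
    · refine Tendsto.const_mul _ ?_
      unfold fa
      have h := (Complex.continuous_ofReal.tendsto 1).comp (chi_tendsto hy)
      simpa using h.mul_const (f y)

lemma main1 {k : ℂ} (hk : 0 < k.im) {f : E3 → ℂ} (hf : ContDiff ℝ (⊤ : ℕ∞) f)
    (hc : HasCompactSupport f) {R : ℝ} (hR : 0 < R) :
    ∫⁻ σ : Sph, ENNReal.ofReal (‖mu2 k f R σ‖ ^ 2) ∂nu ≤
      ENNReal.ofReal (8 * (1 / ‖k‖ ^ 2 + 1 / (‖k‖ * k.im ^ 2)) * ∫ x, ‖f x‖ ^ 2 * wt x) := by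
  have hfa : ∀ n, ContDiff ℝ (⊤ : ℕ∞) (fa f n) := fun n =>
    (Complex.ofRealCLM.contDiff.comp (chi_smooth n)).mul hf
  have hfc : ∀ n, HasCompactSupport (fa f n) := fun n => hc.mul_left
  have hfz : ∀ n, fa f n =ᶠ[𝓝 0] 0 := fun n => by
    filter_upwards [chi_zero n] with x hx
    simp [fa, hx]
  have hIntg : ∀ n, ∫ x, ‖fa f n x‖ ^ 2 * wt x ≤ ∫ x, ‖f x‖ ^ 2 * wt x := fun n => by
    refine integral_mono (wt_integrable (hfa n).continuous (hfc n)) (wt_integrable hf.continuous hc)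
      fun x => ?_
    have := fa_le f n x
    have := wt_nonneg x
    simp only
    gcongr
  have hb : ∀ n, ∫⁻ σ : Sph, ENNReal.ofReal (‖mu2 k (fa f n) R σ‖ ^ 2) ∂nu ≤
      ENNReal.ofReal (8 * (1 / ‖k‖ ^ 2 + 1 / (‖k‖ * k.im ^ 2)) * ∫ x, ‖f x‖ ^ 2 * wt x) := fun n => by
    obtain ⟨h1, h2⟩ := main0 hk (hfa n) (hfc n) (hfz n) hR
    rw [← ofReal_integral_eq_lintegral_ofReal (integrable_sph (by fun_prop))
      (.of_forall fun σ => by positivity)]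
    refine ENNReal.ofReal_le_ofReal (h2.trans ?_)
    have := hIntg n
    gcongr
  have hm : ∀ n, Measurable fun σ : Sph => ENNReal.ofReal (‖mu2 k (fa f n) R σ‖ ^ 2) := fun n => by
    obtain ⟨h1, -⟩ := main0 hk (hfa n) (hfc n) (hfz n) hR
    exact (ENNReal.continuous_ofReal.comp (h1.norm.pow 2)).measurable
  calc ∫⁻ σ : Sph, ENNReal.ofReal (‖mu2 k f R σ‖ ^ 2) ∂nu
      ≤ ∫⁻ σ : Sph, liminf (fun n => ENNReal.ofReal (‖mu2 k (fa f n) R σ‖ ^ 2)) atTop ∂nu := by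
        refine lintegral_mono fun σ => ?_
        by_cases hi : Integrable fun y => _root_.ker k R σ y * f y
        · have h := mu2_lim k R σ hi hf.continuous
          exact (((ENNReal.continuous_ofReal.tendsto _).comp (h.norm.pow 2)).liminf_eq).ge
        · have : mu2 k f R σ = 0 := by
            unfold mu2
            rw [integral_undef hi, mul_zero]
          simp [this]
    _ ≤ liminf (fun n => ∫⁻ σ : Sph, ENNReal.ofReal (‖mu2 k (fa f n) R σ‖ ^ 2) ∂nu) atTop :=
        lintegral_liminf_le hm
    _ ≤ _ := by
        refine liminf_le_of_le (by isBoundedDefault) fun b hb' => ?_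
        obtain ⟨n, hn⟩ := hb'.exists
        exact hn.trans (hb n)

lemma main2 {k : ℂ} (hk : 0 < k.im) {f : E3 → ℂ} (hf : ContDiff ℝ (⊤ : ℕ∞) f)
    (hc : HasCompactSupport f) {R : ℝ} (hR : 0 < R) :
    ∫ σ in sphere (0 : E3) 1, ‖mu2 k f R σ‖ ^ 2 ∂μH[2] ≤
      6144 * (8 * (1 / ‖k‖ ^ 2 + 1 / (‖k‖ * k.im ^ 2)) * ∫ x, ‖f x‖ ^ 2 * wt x) := by
  have hI : 0 ≤ ∫ x, ‖f x‖ ^ 2 * wt x := integral_nonneg fun x => by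
    have := wt_nonneg x
    simp only [Pi.zero_apply]
    positivity
  by_cases hi : Integrable (fun σ => ‖mu2 k f R σ‖ ^ 2) ((μH[2] : Measure E3).restrict (sphere 0 1))
  swap
  · rw [integral_undef hi]
    positivity
  rw [integral_eq_lintegral_of_nonneg_ae (.of_forall fun σ => by simp only [Pi.zero_apply]; positivity)
    hi.aestronglyMeasurable]
  refine ENNReal.toReal_le_of_le_ofReal (by positivity) ?_
  calc ∫⁻ σ in sphere (0 : E3) 1, ENNReal.ofReal (‖mu2 k f R σ‖ ^ 2) ∂μH[2]
      ≤ ∫⁻ σ, ENNReal.ofReal (‖mu2 k f R σ‖ ^ 2) ∂((6144 : ℝ≥0∞) • nu.map Subtype.val) :=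
        lintegral_mono' sphere_measure_le le_rfl
    _ = 6144 * ∫⁻ σ : Sph, ENNReal.ofReal (‖mu2 k f R σ‖ ^ 2) ∂nu := by
        rw [lintegral_smul_measure, smul_eq_mul,
          (MeasurableEmbedding.subtype_coe isClosed_sphere.measurableSet).lintegral_map]
    _ ≤ 6144 * ENNReal.ofReal (8 * (1 / ‖k‖ ^ 2 + 1 / (‖k‖ * k.im ^ 2)) * ∫ x, ‖f x‖ ^ 2 * wt x) := by
        gcongr
        exact main1 hk hf hc hR
    _ = _ := by
        rw [ENNReal.ofReal_mul (p := 6144) (by norm_num)]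
        simp

end Mu2

/-- Uniform-in-`r` bound for `‖μ₂(r,·)‖_{L²(S²)}` in terms of the
weighted norm `‖f‖_{2,w}`, for `k ∈ ℂ⁺` and `f ∈ C_c^∞(ℝ³; ℂ)`. -/
theorem stmt_4 :
    ∃ C : ℝ, 0 < C ∧
      ∀ k : ℂ, 0 < k.im →
        ∀ f : EuclideanSpace ℝ (Fin 3) → ℂ,
          ContDiff ℝ (⊤ : ℕ∞) f → HasCompactSupport f →
          ∀ r : ℝ, 0 < r →
            Real.sqrt (∫ σ in sphere (0 : EuclideanSpace ℝ (Fin 3)) 1,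
                ‖mu2 k f r σ‖ ^ 2 ∂μH[2]) ≤
              C * Real.sqrt (1 / ‖k‖ ^ 2 + 1 / (‖k‖ ^ 2 * k.im ^ 2)
                  + 1 / (‖k‖ * Real.sqrt k.im) + 1 / (‖k‖ * k.im ^ 2)) *
                Real.sqrt (∫ x : EuclideanSpace ℝ (Fin 3), ‖f x‖ ^ 2 * wt x) := by
  refine ⟨Real.sqrt (6144 * 8), by positivity, fun k hk f hf hc r hr => ?_⟩
  have h := Mu2.main2 hk hf hc hr
  have hI : 0 ≤ ∫ x, ‖f x‖ ^ 2 * wt x := integral_nonneg fun x => by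
    have := Mu2.wt_nonneg x
    simp only [Pi.zero_apply]
    positivity
  have h1 : (0 : ℝ) ≤ 1 / (‖k‖ ^ 2 * k.im ^ 2) := by positivity
  have h2 : (0 : ℝ) ≤ 1 / (‖k‖ * Real.sqrt k.im) := by positivity
  rw [← Real.sqrt_mul (by norm_num), ← Real.sqrt_mul (by positivity)]
  refine Real.sqrt_le_sqrt (h.trans ?_)
  rw [← mul_assoc, ← mul_assoc]
  refine mul_le_mul_of_nonneg_right (mul_le_mul_of_nonneg_left ?_ (by norm_num)) hI
  linarith
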